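/- arXiv:2507.05867 — 3 statements merged into one kernel-verified Lean document; each statement's English description precedes it below -/
import Mathlib

section
/- Let A be an n×n real matrix all of whose complex eigenvalues have negative real part (Hurwitz), let B be a column vector in ℝⁿ, C a row covector on ℝⁿ, and k_f > 0. Assume the frequency-domain condition: for every ω ∈ ℝ, Re( C (iωI − A)⁻¹ B ) < 1/k_f (where A, B, C are viewed as complex matrices). Then there exist a symmetric positive definite n×n real matrix P and ε > 0, depending only on A, B, C and k_f, such that: for every function h : ℝ → ℝ satisfying the slope restriction with constant k_f, every vector B_w ∈ ℝⁿ, every continuous w : [0,∞) → ℝ, and every pair of continuously differentiable solutions x, x̃ : [0,∞) → ℝⁿ of the Lur'e system ẋ(t) = A x(t) + B h(C x(t)) + B_w w(t) (with the same disturbance w), the function V(t) = (x(t) − x̃(t))ᵀ P (x(t) − x̃(t)) satisfies V'(t) ≤ −ε V(t) for all t ≥ 0. -/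
open Matrix Set

lemma lure_isometry_eigenvalue_norm {E : Type*} [NormedAddCommGroup E] [InnerProductSpace ℂ E]
    (U : E →ₗᵢ[ℂ] E) (v : E) (hv : v ≠ 0) (μ : ℂ) (h : U v = μ • v) : ‖μ‖ = 1 := by
  have h1 := U.norm_map v
  rw [h, norm_smul] at h1
  have : ‖v‖ ≠ 0 := norm_ne_zero_iff.mpr hv
  field_simp at h1
  exact h1

lemma lure_isometry_eigenbasis {E : Type*} [NormedAddCommGroup E] [InnerProductSpace ℂ E]
    [FiniteDimensional ℂ E] (U : E →ₗᵢ[ℂ] E) :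
    ∃ (m : ℕ) (b : OrthonormalBasis (Fin m) ℂ E) (l : Fin m → ℂ),
      ∀ i, U (b i) = l i • b i := by
  classical
  set T : Module.End ℂ E := U.toLinearMap with hT
  have hTU : ∀ v, T v = U v := fun v => rfl
  have hfam : OrthogonalFamily ℂ (fun μ : Module.End.Eigenvalues T => Module.End.eigenspace T μ)
      fun μ => (Module.End.eigenspace T μ).subtypeₗᵢ := by
    rintro μ ν hμν ⟨v, hv⟩ ⟨w, hw⟩
    by_cases hv' : v = 0
    · simp [hv']
    rw [Module.End.mem_eigenspace_iff] at hv hw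
    have hn := lure_isometry_eigenvalue_norm U v hv' _ hv
    have h1 := U.inner_map_map v w
    rw [← hTU, ← hTU, hv, hw, inner_smul_left, inner_smul_right, ← mul_assoc] at h1
    by_contra hne
    have hne' : inner ℂ v w ≠ 0 := hne
    have h2 : (starRingEnd ℂ) (μ : ℂ) * (ν : ℂ) = 1 := by
      exact mul_right_cancel₀ hne' (by rw [h1, one_mul])
    have h3 : (starRingEnd ℂ) (μ : ℂ) * (μ : ℂ) = 1 := by
      rw [mul_comm, Complex.mul_conj, Complex.normSq_eq_norm_sq]
      have : ‖(μ : ℂ)‖ = 1 := hn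
      rw [this]; simp
    have h4 : (starRingEnd ℂ) (μ : ℂ) ≠ 0 := by
      intro h; rw [h] at h3; simp at h3
    apply hμν
    exact Subtype.ext (mul_left_cancel₀ h4 (h3.trans h2.symm))
  have hinv : ∀ v ∈ (⨆ μ : ℂ, Module.End.eigenspace T μ)ᗮ,
      T v ∈ (⨆ μ : ℂ, Module.End.eigenspace T μ)ᗮ := by
    intro v hv
    rw [← Submodule.iInf_orthogonal, Submodule.mem_iInf] at hv ⊢
    intro μ
    rw [Submodule.mem_orthogonal]
    intro w hw
    by_cases hw' : w = 0
    · simp [hw']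
    have h0 := (Submodule.mem_orthogonal _ _).1 (hv μ) w hw
    rw [Module.End.mem_eigenspace_iff] at hw
    have hn := lure_isometry_eigenvalue_norm U w hw' _ hw
    have h1 := U.inner_map_map w v
    rw [← hTU, ← hTU, hw, inner_smul_left, h0] at h1
    rcases mul_eq_zero.1 h1 with h | h
    · rw [map_eq_zero] at h
      rw [h] at hn; simp at hn
    · exact h
  have hbot : (⨆ μ : ℂ, Module.End.eigenspace T μ)ᗮ = ⊥ := by
    by_contra hne
    have hnt := Submodule.nontrivial_iff_ne_bot.2 hne
    obtain ⟨c, hc⟩ := Module.End.exists_eigenvalue (T.restrict hinv)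
    obtain ⟨w, hw⟩ := hc.exists_hasEigenvector
    have hw1 := hw.apply_eq_smul
    have hw2 : T w = c • (w : E) := by
      have := congrArg Subtype.val hw1
      simpa using this
    have hw3 : (w : E) ∈ ⨆ μ : ℂ, Module.End.eigenspace T μ :=
      (le_iSup (fun μ : ℂ => Module.End.eigenspace T μ) c)
        (Module.End.mem_eigenspace_iff.2 hw2)
    have h0 := (Submodule.mem_orthogonal _ _).1 w.2 _ hw3
    rw [inner_self_eq_zero] at h0
    exact hw.2 (Subtype.ext h0)
  have hbot' : (⨆ μ : Module.End.Eigenvalues T, Module.End.eigenspace T μ)ᗮ = ⊥ :=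
    show (⨆ μ : { μ // Module.End.eigenspace T μ ≠ ⊥ }, Module.End.eigenspace T μ)ᗮ = ⊥ by
      rw [iSup_ne_bot_subtype, hbot]
  have hInternal : DirectSum.IsInternal fun μ : Module.End.Eigenvalues T => Module.End.eigenspace T μ :=
    hfam.isInternal_iff.mpr hbot'
  refine ⟨_, hInternal.subordinateOrthonormalBasis rfl hfam,
    fun i => ((hInternal.subordinateOrthonormalBasisIndex rfl i hfam : Module.End.Eigenvalues T) : ℂ), fun i => ?_⟩
  have := hInternal.subordinateOrthonormalBasis_subordinate rfl i hfam
  exact Module.End.mem_eigenspace_iff.1 this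

lemma lure_exists_isometry {E : Type*} [NormedAddCommGroup E] [InnerProductSpace ℂ E]
    [FiniteDimensional ℂ E] {n : ℕ} (X Y : Fin n → E)
    (h : ∀ p q, inner ℂ (X p) (X q) = inner ℂ (Y p) (Y q)) :
    ∃ U : E →ₗᵢ[ℂ] E, ∀ p, U (X p) = Y p := by
  let f : (Fin n → ℂ) →ₗ[ℂ] E := Fintype.linearCombination ℂ X
  let g : (Fin n → ℂ) →ₗ[ℂ] E := Fintype.linearCombination ℂ Y
  have hfg : ∀ c, ‖f c‖ = ‖g c‖ := by
    intro c
    have : inner ℂ (f c) (f c) = inner ℂ (g c) (g c) := by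
      simp only [f, g, Fintype.linearCombination_apply, sum_inner, inner_sum, inner_smul_left,
        inner_smul_right, h]
    rw [inner_self_eq_norm_sq_to_K, inner_self_eq_norm_sq_to_K] at this
    have h2 : ‖f c‖ ^ 2 = ‖g c‖ ^ 2 := by exact_mod_cast this
    exact (sq_eq_sq₀ (norm_nonneg _) (norm_nonneg _)).1 h2
  obtain ⟨s, hs⟩ := LinearMap.exists_rightInverse_of_surjective f.rangeRestrict
    f.range_rangeRestrict
  have hs' : ∀ v : LinearMap.range f, f (s v) = v := by
    intro v
    have := congrArg Subtype.val (LinearMap.congr_fun hs v)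
    simpa using this
  let L : LinearMap.range f →ₗᵢ[ℂ] E := ⟨g.comp s, fun v => by
    rw [LinearMap.comp_apply, ← hfg, hs']; rfl⟩
  refine ⟨L.extend, fun p => ?_⟩
  have hX : f (Pi.single p 1) = X p := by simp [f]
  have hY : g (Pi.single p 1) = Y p := by simp [g]
  have h1 := L.extend_apply ⟨f (Pi.single p 1), LinearMap.mem_range_self f _⟩
  rw [← hX, ← hY]
  refine h1.trans ?_
  change g (s _) = _
  rw [← sub_eq_zero, ← map_sub, ← norm_eq_zero, ← hfg, map_sub, hs']
  simp

lemma lure_mode {n : ℕ} (A : Matrix (Fin n) (Fin n) ℝ) (B C : Fin n → ℝ) (k_f : ℝ)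
    (hk_f : 0 < k_f)
    (hHurwitz : ∀ μ ∈ spectrum ℂ (A.map (fun a : ℝ => (a : ℂ))), μ.re < 0)
    (hfreq : ∀ ω : ℝ,
      ((fun i => (C i : ℂ)) ⬝ᵥ
        (((Complex.I * (ω : ℂ)) • (1 : Matrix (Fin n) (Fin n) ℂ)
            - A.map (fun a : ℝ => (a : ℂ)))⁻¹ *ᵥ fun i => (B i : ℂ))).re < 1 / k_f)
    (ξ : Fin n → ℂ) (υ l : ℂ) (hl : ‖l‖ = 1)
    (h : ξ + (A.map (fun a : ℝ => (a : ℂ)) *ᵥ ξ + υ • fun i => (B i : ℂ)) =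
      l • (ξ - (A.map (fun a : ℝ => (a : ℂ)) *ᵥ ξ + υ • fun i => (B i : ℂ)))) :
    (υ = 0 ∧ ξ = 0) ∨
      ((starRingEnd ℂ) υ * ((fun i => (C i : ℂ)) ⬝ᵥ ξ)).re - ‖υ‖ ^ 2 / k_f < 0 := by
  set Ac := A.map (fun a : ℝ => (a : ℂ)) with hAc
  set Bc : Fin n → ℂ := fun i => (B i : ℂ) with hBc
  set Cc : Fin n → ℂ := fun i => (C i : ℂ) with hCc
  by_cases hl1 : l = -1
  · have hξ : ξ = 0 := by
      rw [hl1] at h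
      ext i
      have := congrFun h i
      simp only [Pi.add_apply, Pi.smul_apply, Pi.sub_apply, smul_eq_mul] at this
      simp only [Pi.zero_apply]
      linear_combination (1/2) * this
    by_cases hυ : υ = 0
    · exact Or.inl ⟨hυ, hξ⟩
    · right
      have : 0 < ‖υ‖ := norm_pos_iff.2 hυ
      rw [hξ]
      simp only [dotProduct_zero, mul_zero, Complex.zero_re]
      have : 0 < ‖υ‖ ^ 2 / k_f := by positivity
      linarith
  · have hl2 : l + 1 ≠ 0 := fun h => hl1 (eq_neg_of_add_eq_zero_left h)
    have hre : ((l - 1) / (l + 1)).re = 0 := by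
      rw [Complex.div_re, ← add_div]
      have h1 : l.re * l.re + l.im * l.im = 1 := by
        have := Complex.normSq_eq_norm_sq l
        rw [hl, Complex.normSq_apply] at this
        simpa using this
      have : (l - 1).re * (l + 1).re + (l - 1).im * (l + 1).im = 0 := by
        simp; linear_combination h1
      rw [this, zero_div]
    obtain ⟨ω, hω⟩ : ∃ ω : ℝ, (l - 1) / (l + 1) = Complex.I * ω := by
      refine ⟨((l - 1) / (l + 1)).im, ?_⟩
      apply Complex.ext
      · rw [hre]; simp
      · simp
    have hunit : IsUnit ((Complex.I * (ω : ℂ)) • (1 : Matrix (Fin n) (Fin n) ℂ) - Ac) := by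
      by_contra hnu
      have : (Complex.I * (ω : ℂ)) ∈ spectrum ℂ Ac := by
        rw [spectrum.mem_iff, Algebra.algebraMap_eq_smul_one]
        exact hnu
      have := hHurwitz _ this
      simp at this
    have heq : ((Complex.I * (ω : ℂ)) • (1 : Matrix (Fin n) (Fin n) ℂ) - Ac) *ᵥ ξ = υ • Bc := by
      rw [sub_mulVec, smul_mulVec, one_mulVec, ← hω]
      ext i
      have := congrFun h i
      simp only [Pi.add_apply, Pi.smul_apply, Pi.sub_apply, smul_eq_mul] at this ⊢
      field_simp
      linear_combination (-1 : ℂ) * this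
    have hξ : ξ = υ • (((Complex.I * (ω : ℂ)) • (1 : Matrix (Fin n) (Fin n) ℂ) - Ac)⁻¹ *ᵥ Bc) := by
      rw [← mulVec_smul, ← heq, mulVec_mulVec, nonsing_inv_mul _
        ((Matrix.isUnit_iff_isUnit_det _).1 hunit), one_mulVec]
    by_cases hυ : υ = 0
    · left
      refine ⟨hυ, ?_⟩
      rw [hξ, hυ, zero_smul]
    · right
      have hpos : 0 < ‖υ‖ ^ 2 := by have := norm_pos_iff.2 hυ; positivity
      have hf := hfreq ω
      rw [hξ, dotProduct_smul, smul_eq_mul, ← mul_assoc, mul_comm ((starRingEnd ℂ) υ),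
        Complex.mul_conj, Complex.re_ofReal_mul, Complex.normSq_eq_norm_sq]
      have := mul_lt_mul_of_pos_left hf hpos
      rw [mul_one_div] at this
      linarith

/-- complexification of a real family -/
noncomputable def lureEmb {ι : Type*} (f : ι → ℝ) : EuclideanSpace ℂ ι :=
  WithLp.toLp 2 (fun j => (f j : ℂ))

lemma lureEmb_inner {ι : Type*} [Fintype ι] (f g : ι → ℝ) :
    inner ℂ (lureEmb f) (lureEmb g) = ((∑ j, f j * g j : ℝ) : ℂ) := by
  simp [lureEmb, PiLp.inner_apply, mul_comm]

lemma lure_dual {n : ℕ} (A : Matrix (Fin n) (Fin n) ℝ) (B C : Fin n → ℝ) (k_f : ℝ)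
    (hk_f : 0 < k_f)
    (hHurwitz : ∀ μ ∈ spectrum ℂ (A.map (fun a : ℝ => (a : ℂ))), μ.re < 0)
    (hfreq : ∀ ω : ℝ,
      ((fun i => (C i : ℂ)) ⬝ᵥ
        (((Complex.I * (ω : ℂ)) • (1 : Matrix (Fin n) (Fin n) ℂ)
            - A.map (fun a : ℝ => (a : ℂ)))⁻¹ *ᵥ fun i => (B i : ℂ))).re < 1 / k_f)
    {ι : Type*} [Fintype ι] (x : ι → Fin n → ℝ) (u : ι → ℝ)
    (h : ∀ p q, ∑ j, (x j p * (A *ᵥ x j + u j • B) q + (A *ᵥ x j + u j • B) p * x j q) = 0)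
    (hM : 0 ≤ ∑ j, (u j * (C ⬝ᵥ x j) - u j ^ 2 / k_f)) :
    ∀ j, x j = 0 ∧ u j = 0 := by
  set a : Fin n → EuclideanSpace ℂ ι := fun p => lureEmb (fun j => x j p) with ha
  set b : Fin n → EuclideanSpace ℂ ι := fun p => lureEmb (fun j => (A *ᵥ x j + u j • B) p) with hb
  set U : EuclideanSpace ℂ ι := lureEmb u with hU
  have hb' : ∀ p, b p = ∑ q, (A p q : ℂ) • a q + (B p : ℂ) • U := by
    intro p
    ext j
    simp [b, a, U, lureEmb, mulVec, dotProduct, mul_comm]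
  obtain ⟨Q, hQ⟩ := lure_exists_isometry (fun p => a p - b p) (fun p => a p + b p) (by
    intro p q
    have h1 : inner ℂ (a p) (b q) + inner ℂ (b p) (a q) = 0 := by
      rw [ha, hb]
      simp only [lureEmb_inner]
      rw [← Complex.ofReal_add, ← Finset.sum_add_distrib, h p q, Complex.ofReal_zero]
    simp only [inner_sub_left, inner_sub_right, inner_add_left, inner_add_right]
    linear_combination (-2 : ℂ) * h1)
  obtain ⟨m, v, l, hv⟩ := lure_isometry_eigenbasis Q
  have hl : ∀ i, ‖l i‖ = 1 := fun i =>
    lure_isometry_eigenvalue_norm Q (v i) (v.orthonormal.ne_zero i) _ (hv i)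
  have hmode := fun i => lure_mode A B C k_f hk_f hHurwitz hfreq
    (fun p => inner ℂ (v i) (a p)) (inner ℂ (v i) U) (l i) (hl i) (by
      have hη : (A.map (fun a : ℝ => (a : ℂ)) *ᵥ (fun p => inner ℂ (v i) (a p))
          + (inner ℂ (v i) U : ℂ) • fun i => (B i : ℂ)) = fun p => inner ℂ (v i) (b p) := by
        ext p
        rw [hb' p]
        simp [mulVec, dotProduct, inner_add_right, inner_sum, inner_smul_right, mul_comm]
      rw [hη]
      ext p
      have h1 := Q.inner_map_map (v i) (a p - b p)
      have h2 := hQ p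
      rw [h2, hv i, inner_smul_left, inner_add_right, inner_sub_right] at h1
      have h3 : l i * (starRingEnd ℂ) (l i) = 1 := by
        rw [Complex.mul_conj, Complex.normSq_eq_norm_sq, hl i]; simp
      simp only [Pi.add_apply, Pi.smul_apply, Pi.sub_apply, smul_eq_mul]
      rw [← h1, ← mul_assoc, h3, one_mul])
  set c : EuclideanSpace ℂ ι := ∑ p, (C p : ℂ) • a p with hc
  have hcv : ∀ i, ((fun i => (C i : ℂ)) ⬝ᵥ (fun p => inner ℂ (v i) (a p))) = inner ℂ (v i) c := by
    intro i
    simp [hc, dotProduct, inner_sum, inner_smul_right]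
  have hce : c = lureEmb (fun j => C ⬝ᵥ x j) := by
    ext j
    simp [hc, a, lureEmb, dotProduct]
  have hsum : ∑ i, (((starRingEnd ℂ) (inner ℂ (v i) U) *
      ((fun i => (C i : ℂ)) ⬝ᵥ (fun p => inner ℂ (v i) (a p)))).re
      - ‖inner ℂ (v i) U‖ ^ 2 / k_f) = ∑ j, (u j * (C ⬝ᵥ x j) - u j ^ 2 / k_f) := by
    simp only [hcv, inner_conj_symm]
    rw [Finset.sum_sub_distrib, Finset.sum_sub_distrib, ← Complex.re_sum, v.sum_inner_mul_inner,
      ← Finset.sum_div, ← Finset.sum_div, v.sum_sq_norm_inner_right, hce, hU, lureEmb_inner,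
      Complex.ofReal_re]
    congr 2
    rw [EuclideanSpace.norm_sq_eq]
    simp [lureEmb]
  have hall : ∀ i, inner ℂ (v i) U = 0 ∧ (fun p => inner ℂ (v i) (a p)) = 0 := by
    by_contra hcon
    push Not at hcon
    obtain ⟨i, hi⟩ := hcon
    have : ∑ i, (((starRingEnd ℂ) (inner ℂ (v i) U) *
      ((fun i => (C i : ℂ)) ⬝ᵥ (fun p => inner ℂ (v i) (a p)))).re
      - ‖inner ℂ (v i) U‖ ^ 2 / k_f) < 0 := by
      apply Finset.sum_neg' 
      · intro i _
        rcases hmode i with ⟨h1, h2⟩ | h1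
        · rw [h1, h2]; simp
        · exact h1.le
      · refine ⟨i, Finset.mem_univ _, ?_⟩
        rcases hmode i with ⟨h1, h2⟩ | h1
        · exact absurd h2 (hi h1)
        · exact h1
    linarith
  have hz : ∀ w : EuclideanSpace ℂ ι, (∀ i, inner ℂ (v i) w = 0) → w = 0 := by
    intro w hw
    have := v.sum_sq_norm_inner_right w
    simp [hw] at this
    have h2 : ‖w‖ ^ 2 = 0 := this.symm
    exact norm_eq_zero.1 (pow_eq_zero_iff two_ne_zero |>.1 h2)
  have hU0 : U = 0 := hz _ fun i => (hall i).1
  have ha0 : ∀ p, a p = 0 := fun p => hz _ fun i => congrFun (hall i).2 p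
  intro j
  constructor
  · ext p
    have := congrArg (fun w : EuclideanSpace ℂ ι => w j) (ha0 p)
    simpa [a, lureEmb] using this
  · have := congrArg (fun w : EuclideanSpace ℂ ι => w j) hU0
    simpa [U, lureEmb] using this

lemma lure_isCompact_convexHull {V : Type*} [NormedAddCommGroup V] [NormedSpace ℝ V]
    [FiniteDimensional ℝ V] {K : Set V} (hK : IsCompact K) (hne : K.Nonempty) :
    IsCompact (convexHull ℝ K) := by
  classical
  obtain ⟨k0, hk0⟩ := hne
  set d := Module.finrank ℝ V
  have hcomp : IsCompact ((stdSimplex ℝ (Fin (d + 1))) ×ˢ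
      (Set.univ.pi fun _ : Fin (d + 1) => K)) :=
    (isCompact_stdSimplex ℝ (Fin (d + 1))).prod (isCompact_univ_pi fun _ => hK)
  have hcont : Continuous (fun p : (Fin (d + 1) → ℝ) × (Fin (d + 1) → V) =>
      ∑ i, p.1 i • p.2 i) := by fun_prop
  have him := hcomp.image hcont
  convert him using 1
  apply Set.Subset.antisymm
  · intro y hy
    obtain ⟨ι, hι, z, w, hz, hai, hw0, hw1, hy⟩ := eq_pos_convex_span_of_mem_convexHull hy
    have hcard : Fintype.card ι ≤ Fintype.card (Fin (d + 1)) := by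
      rw [Fintype.card_fin]
      exact hai.card_le_finrank_succ.trans (Nat.succ_le_succ (Submodule.finrank_le _))
    obtain ⟨e⟩ := Function.Embedding.nonempty_of_card_le hcard
    refine ⟨(Function.extend e w 0, Function.extend e z (fun _ => k0)), ⟨⟨?_, ?_⟩, ?_⟩, ?_⟩
    · intro i
      by_cases hi : ∃ j, e j = i
      · obtain ⟨j, rfl⟩ := hi
        simp only [e.injective.extend_apply]
        exact (hw0 j).le
      · simp [Function.extend_apply' _ _ _ hi]
    · rw [← hw1]
      refine (Finset.sum_of_injOn e e.injective.injOn (by simp) ?_ ?_).symm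
      · intro i _ hi
        exact Function.extend_apply' _ _ _ (by simpa using hi)
      · intro j _
        exact (e.injective.extend_apply _ _ _).symm
    · intro i _
      by_cases hi : ∃ j, e j = i
      · obtain ⟨j, rfl⟩ := hi
        simp only [e.injective.extend_apply]
        exact hz (Set.mem_range_self j)
      · simpa [Function.extend_apply' _ _ _ hi] using hk0
    · rw [← hy]
      refine (Finset.sum_of_injOn e e.injective.injOn (by simp) ?_ ?_).symm
      · intro i _ hi
        have hi' : ¬ ∃ j, e j = i := by simpa using hi
        simp [Function.extend_apply' _ _ _ hi']
      · intro j _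
        simp [e.injective.extend_apply]
  · rintro _ ⟨⟨w, z⟩, ⟨⟨hw0, hw1⟩, hz⟩, rfl⟩
    exact mem_convexHull_of_exists_fintype w z hw0 hw1 (fun i => hz i (Set.mem_univ _)) rfl

lemma lure_pow_tendsto_zero {R : Type*} [NormedRing R] [NormedAlgebra ℂ R] [CompleteSpace R]
    [Nontrivial R] (a : R) (h : ∀ z ∈ spectrum ℂ a, ‖z‖ < 1) :
    Filter.Tendsto (fun k : ℕ => a ^ k) Filter.atTop (nhds 0) := by
  have h1 : spectralRadius ℂ a < ((1 : NNReal) : ENNReal) :=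
    spectrum.spectralRadius_lt_of_forall_lt a (r := 1) (fun z hz => by exact_mod_cast h z hz)
  obtain ⟨r, hr1, hr2⟩ := ENNReal.lt_iff_exists_nnreal_btwn.1 h1
  have hr2' : (r : ℝ) < 1 := by exact_mod_cast hr2
  have hev := (spectrum.pow_nnnorm_pow_one_div_tendsto_nhds_spectralRadius a).eventually_lt_const hr1
  apply squeeze_zero_norm' _ (tendsto_pow_atTop_nhds_zero_of_lt_one r.2 hr2')
  filter_upwards [hev, Filter.eventually_gt_atTop 0] with k hk hk0
  have hk' : (0 : ℝ) < k := by exact_mod_cast hk0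
  have h2 : (‖a ^ k‖₊ : ENNReal) ≤ (r : ENNReal) ^ k := by
    have := ENNReal.rpow_le_rpow hk.le hk'.le
    rw [← ENNReal.rpow_mul, one_div, inv_mul_cancel₀ hk'.ne', ENNReal.rpow_one,
      ENNReal.rpow_natCast] at this
    exact this
  exact_mod_cast h2

section
attribute [local instance] Matrix.linftyOpNormedRing Matrix.linftyOpNormedAlgebra
  Matrix.linftyOpNormedAddCommGroup Matrix.linftyOpNormedSpace

lemma lure_matrix_pow_tendsto_zero {n : ℕ} [NeZero n] (a : Matrix (Fin n) (Fin n) ℂ)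
    (h : ∀ z ∈ spectrum ℂ a, ‖z‖ < 1) (i j : Fin n) :
    Filter.Tendsto (fun k : ℕ => (a ^ k) i j) Filter.atTop (nhds 0) := by
  have : CompleteSpace (Matrix (Fin n) (Fin n) ℂ) := FiniteDimensional.complete ℂ _
  have h1 := lure_pow_tendsto_zero a h
  have h2 : Continuous (fun M : Matrix (Fin n) (Fin n) ℂ => M i j) := by
    exact continuous_id.matrix_elem i j
  exact (h2.tendsto 0).comp h1
end

lemma lure_posDef {n : ℕ} (A P : Matrix (Fin n) (Fin n) ℝ)
    (hHurwitz : ∀ μ ∈ spectrum ℂ (A.map (fun a : ℝ => (a : ℂ))), μ.re < 0)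
    (hP : P.IsSymm) (hlyap : ∀ x, x ≠ 0 → x ⬝ᵥ (P *ᵥ (A *ᵥ x)) < 0) (v : Fin n → ℝ)
    (hv : v ≠ 0) : 0 < v ⬝ᵥ (P *ᵥ v) := by
  rcases Nat.eq_zero_or_pos n with hn | hn
  · subst hn; exact absurd (Subsingleton.elim _ _) hv
  have : NeZero n := ⟨hn.ne'⟩
  let φ : Matrix (Fin n) (Fin n) ℝ →+* Matrix (Fin n) (Fin n) ℂ := Complex.ofRealHom.mapMatrix
  have hφ : φ A = A.map (fun a : ℝ => (a : ℂ)) := rfl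
  rw [← hφ] at hHurwitz
  have hunit : IsUnit (1 - A) := by
    rw [Matrix.isUnit_iff_isUnit_det, isUnit_iff_ne_zero]
    intro h0
    have h1 : (φ (1 - A)).det = 0 := by
      rw [← RingHom.map_det, h0, map_zero]
    have h2 : (1 : ℂ) ∈ spectrum ℂ (φ A) := by
      rw [spectrum.mem_iff, map_one, Matrix.isUnit_iff_isUnit_det, isUnit_iff_ne_zero]
      rw [map_sub, map_one] at h1
      simpa using h1
    have := hHurwitz _ h2
    simp at this
    linarith
  have hdet := (Matrix.isUnit_iff_isUnit_det _).1 hunit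
  set S := (1 - A)⁻¹ with hS
  have hS1 : (1 - A) * S = 1 := mul_nonsing_inv _ hdet
  set T := (1 + A) * S with hT
  have hspec : ∀ z ∈ spectrum ℂ (φ T), ‖z‖ < 1 := by
    intro z hz
    rw [spectrum.mem_iff, Matrix.isUnit_iff_isUnit_det, isUnit_iff_ne_zero, not_not,
      ← Matrix.exists_mulVec_eq_zero_iff] at hz
    obtain ⟨y, hy0, hy⟩ := hz
    set w := φ S *ᵥ y with hw
    have hyw : y = w - φ A *ᵥ w := by
      have h1 : φ (1 - A) * φ S = 1 := by rw [← map_mul, hS1, map_one]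
      rw [hw]
      have : (φ (1 - A) * φ S) *ᵥ y = y := by rw [h1, one_mulVec]
      rw [← mulVec_mulVec, map_sub, map_one, sub_mulVec, one_mulVec] at this
      exact this.symm
    have hTy : φ T *ᵥ y = w + φ A *ᵥ w := by
      rw [hT, map_mul, ← mulVec_mulVec, map_add, map_one, add_mulVec, one_mulVec]
    rw [sub_mulVec, hTy, Algebra.algebraMap_eq_smul_one, smul_mulVec, one_mulVec, hyw] at hy
    have hw0 : w ≠ 0 := by
      intro h
      apply hy0
      rw [hyw, h]; simp
    have hz1 : z + 1 ≠ 0 := by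
      intro h
      have : z = -1 := eq_neg_of_add_eq_zero_left h
      apply hw0
      ext i
      have h3 := congrFun hy i
      rw [this] at h3
      simp only [Pi.add_apply, Pi.smul_apply, Pi.sub_apply, smul_eq_mul, Pi.zero_apply] at h3 ⊢
      linear_combination (-1/2) * h3
    have hmem : (z - 1) / (z + 1) ∈ spectrum ℂ (φ A) := by
      rw [spectrum.mem_iff, Matrix.isUnit_iff_isUnit_det, isUnit_iff_ne_zero, not_not,
        ← Matrix.exists_mulVec_eq_zero_iff]
      refine ⟨w, hw0, ?_⟩
      rw [sub_mulVec, Algebra.algebraMap_eq_smul_one, smul_mulVec, one_mulVec]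
      ext i
      have h3 := congrFun hy i
      simp only [Pi.add_apply, Pi.smul_apply, Pi.sub_apply, smul_eq_mul, Pi.zero_apply] at h3 ⊢
      field_simp
      linear_combination h3
    have hre := hHurwitz _ hmem
    rw [Complex.div_re, ← add_div] at hre
    have hpos : 0 < Complex.normSq (z + 1) := Complex.normSq_pos.2 hz1
    rw [div_lt_iff₀ hpos, zero_mul] at hre
    simp at hre
    have h5 : Complex.normSq z < 1 := by
      rw [Complex.normSq_apply]; nlinarith
    rw [Complex.normSq_eq_norm_sq] at h5
    nlinarith [norm_nonneg z]
  have hpow : ∀ i j, Filter.Tendsto (fun k : ℕ => (T ^ k) i j) Filter.atTop (nhds 0) := by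
    intro i j
    have h1 := lure_matrix_pow_tendsto_zero (φ T) hspec i j
    have h2 : ∀ k : ℕ, ((φ T) ^ k) i j = (((T ^ k) i j : ℝ) : ℂ) := by
      intro k; rw [← map_pow]; rfl
    simp only [h2] at h1
    have h3 := (Complex.continuous_re.tendsto 0).comp h1
    simpa [Function.comp_def] using h3
  set q : (Fin n → ℝ) → ℝ := fun v => v ⬝ᵥ (P *ᵥ v) with hq
  have hdec : ∀ y, y ≠ 0 → q (T *ᵥ y) < q y := by
    intro y hy0
    set w := S *ᵥ y with hw
    have hyw : y = w - A *ᵥ w := by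
      have : ((1 - A) * S) *ᵥ y = y := by rw [hS1, one_mulVec]
      rw [← mulVec_mulVec, sub_mulVec, one_mulVec] at this
      exact this.symm
    have hTy : T *ᵥ y = w + A *ᵥ w := by
      rw [hT, ← mulVec_mulVec, add_mulVec, one_mulVec]
    have hw0 : w ≠ 0 := by
      intro h
      apply hy0
      rw [hyw, h]; simp
    have h1 := hlyap w hw0
    have h2 : (A *ᵥ w) ⬝ᵥ (P *ᵥ w) = w ⬝ᵥ (P *ᵥ (A *ᵥ w)) := by
      rw [dotProduct_mulVec, ← mulVec_transpose, hP.eq, dotProduct_comm]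
    rw [hTy]
    conv_rhs => rw [hyw]
    simp only [hq, mulVec_add, mulVec_sub, dotProduct_add, add_dotProduct, dotProduct_sub,
      sub_dotProduct]
    linarith
  have hdec' : ∀ y, q (T *ᵥ y) ≤ q y := by
    intro y
    by_cases hy : y = 0
    · simp [hy]
    · exact (hdec y hy).le
  have hanti : ∀ y, Antitone (fun k : ℕ => q (T ^ k *ᵥ y)) := by
    intro y
    apply antitone_nat_of_succ_le
    intro k
    rw [pow_succ', ← mulVec_mulVec]
    exact hdec' _
  have hlim : ∀ y, Filter.Tendsto (fun k : ℕ => q (T ^ k *ᵥ y)) Filter.atTop (nhds 0) := by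
    intro y
    have hqc : Continuous q := by
      simp only [hq, dotProduct, mulVec]
      fun_prop
    have h1 : Filter.Tendsto (fun k : ℕ => T ^ k *ᵥ y) Filter.atTop (nhds 0) := by
      rw [tendsto_pi_nhds]
      intro i
      have : Filter.Tendsto (fun k : ℕ => ∑ j, (T ^ k) i j * y j) Filter.atTop
          (nhds (∑ j, 0 * y j)) :=
        tendsto_finsetSum _ fun j _ => (hpow i j).mul_const _
      simpa [mulVec, dotProduct] using this
    have h2 := (hqc.tendsto 0).comp h1
    have h3 : q 0 = 0 := by simp [hq]
    rw [h3] at h2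
    exact h2
  have h0 : 0 ≤ q (T *ᵥ v) := by
    have := (hanti (T *ᵥ v)).le_of_tendsto (hlim (T *ᵥ v)) 0
    simpa using this
  exact h0.trans_lt (hdec v hv)

lemma lure_kyp {n : ℕ} (A : Matrix (Fin n) (Fin n) ℝ) (B C : Fin n → ℝ) (k_f : ℝ)
    (hk_f : 0 < k_f)
    (hHurwitz : ∀ μ ∈ spectrum ℂ (A.map (fun a : ℝ => (a : ℂ))), μ.re < 0)
    (hfreq : ∀ ω : ℝ,
      ((fun i => (C i : ℂ)) ⬝ᵥ
        (((Complex.I * (ω : ℂ)) • (1 : Matrix (Fin n) (Fin n) ℂ)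
            - A.map (fun a : ℝ => (a : ℂ)))⁻¹ *ᵥ fun i => (B i : ℂ))).re < 1 / k_f) :
    ∃ (P : Matrix (Fin n) (Fin n) ℝ) (δ : ℝ), P.IsSymm ∧ 0 < δ ∧
      ∀ (x : Fin n → ℝ) (u : ℝ), 0 ≤ u * (C ⬝ᵥ x) - u ^ 2 / k_f →
        x ⬝ᵥ (P *ᵥ (A *ᵥ x + u • B)) ≤ -δ * ‖x‖ ^ 2 := by
  classical
  let ψ : (Fin n → ℝ) × ℝ → (Fin n → Fin n → ℝ) × ℝ := fun z =>
    (fun p q => z.1 p * (A *ᵥ z.1 + z.2 • B) q + (A *ᵥ z.1 + z.2 • B) p * z.1 q,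
      z.2 * (C ⬝ᵥ z.1) - z.2 ^ 2 / k_f)
  have hψ : Continuous ψ := by
    simp only [ψ, dotProduct, mulVec, Pi.add_apply, Pi.smul_apply]
    fun_prop
  set K := ψ '' Metric.sphere 0 1 with hK
  have hKc : IsCompact K := (isCompact_sphere _ _).image hψ
  have hKne : K.Nonempty := ⟨_, (0, 1), by simp, rfl⟩
  have hSc := lure_isCompact_convexHull hKc hKne
  let t : Set ((Fin n → Fin n → ℝ) × ℝ) := {0} ×ˢ Ici 0
  have ht1 : Convex ℝ t := (convex_singleton 0).prod (convex_Ici 0)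
  have ht2 : IsClosed t := isClosed_singleton.prod isClosed_Ici
  have hdisj : Disjoint (convexHull ℝ K) t := by
    rw [Set.disjoint_left]
    rintro y hy ⟨hy1, hy2⟩
    obtain ⟨ι, _, w, z, hw0, hw1, hz, hsum⟩ := mem_convexHull_iff_exists_fintype.1 hy
    choose ζ hζ hζz using hz
    have hsq : ∀ i, √(w i) * √(w i) = w i := fun i => Real.mul_self_sqrt (hw0 i)
    have hzero := lure_dual A B C k_f hk_f hHurwitz hfreq
      (fun i => √(w i) • (ζ i).1) (fun i => √(w i) * (ζ i).2) (by
        intro p q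
        have h1 : y.1 p q = 0 := by rw [show y.1 = 0 from hy1]; rfl
        rw [← hsum, Prod.fst_sum, Finset.sum_apply, Finset.sum_apply] at h1
        rw [← h1]
        refine Finset.sum_congr rfl fun i _ => ?_
        rw [← hζz i]
        simp only [ψ, mulVec_smul, Pi.add_apply, Pi.smul_apply, smul_eq_mul, Prod.smul_fst]
        rw [← hsq i]
        simp only [hsq i]
        linear_combination ((ζ i).1 p * ((A *ᵥ (ζ i).1) q + (ζ i).2 * B q)
          + ((A *ᵥ (ζ i).1) p + (ζ i).2 * B p) * (ζ i).1 q) * hsq i) (by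
        have h1 : 0 ≤ y.2 := hy2
        rw [← hsum, Prod.snd_sum] at h1
        refine h1.trans_eq ?_
        refine Finset.sum_congr rfl fun i _ => ?_
        rw [← hζz i]
        simp only [ψ, dotProduct_smul, smul_eq_mul, Prod.smul_snd]
        linear_combination (-(ζ i).2 * (C ⬝ᵥ (ζ i).1) + (ζ i).2 ^ 2 / k_f) * hsq i)
    have hw : ∀ i, w i = 0 := by
      intro i
      obtain ⟨h1, h2⟩ := hzero i
      by_contra hne
      have hne' : √(w i) ≠ 0 := fun h => hne (by rw [← hsq i, h, mul_zero])
      have h3 : (ζ i).1 = 0 := (smul_eq_zero.1 h1).resolve_left hne'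
      have h4 : (ζ i).2 = 0 := (mul_eq_zero.1 h2).resolve_left hne'
      have h5 : ζ i = 0 := Prod.ext h3 h4
      have h6 := hζ i
      rw [h5] at h6
      simp at h6
    simp [hw] at hw1
  obtain ⟨f, u0, v0, hf1, huv, hf2⟩ := geometric_hahn_banach_compact_closed
    (convex_convexHull ℝ K) hSc ht1 ht2 hdisj
  have hv0 : v0 < 0 := by
    have := hf2 0 ⟨rfl, by simp⟩
    simpa using this
  have hu0 : u0 < 0 := huv.trans hv0
  set c := f (0, 1) with hc
  have hfr : ∀ r : ℝ, f (0, r) = r * c := by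
    intro r
    rw [hc, ← smul_eq_mul, ← map_smul]
    simp
  have hc0 : 0 ≤ c := by
    by_contra hneg
    push Not at hneg
    have := hf2 (0, v0 / c) ⟨rfl, (div_pos_of_neg_of_neg hv0 hneg).le⟩
    rw [hfr, div_mul_cancel₀ _ hneg.ne] at this
    exact lt_irrefl _ this
  let F : Matrix (Fin n) (Fin n) ℝ := fun p q => f (Pi.single p (Pi.single q 1), 0)
  have hF : ∀ Y : Fin n → Fin n → ℝ, f (Y, 0) = ∑ p, ∑ q, Y p q * F p q := by
    intro Y
    have hY : ((Y, 0) : (Fin n → Fin n → ℝ) × ℝ)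
        = ∑ p, ∑ q, Y p q • (Pi.single p (Pi.single q 1), (0 : ℝ)) := by
      refine Prod.ext ?_ ?_
      · ext p q
        simp [Prod.fst_sum, Finset.sum_apply, Pi.single_apply, apply_ite, ite_apply]
      · simp [Prod.snd_sum]
    rw [hY]
    simp only [map_sum, map_smul, smul_eq_mul, F]
  have hfg : ∀ z, f (ψ z) = z.1 ⬝ᵥ ((F + Fᵀ) *ᵥ (A *ᵥ z.1 + z.2 • B))
      + c * (z.2 * (C ⬝ᵥ z.1) - z.2 ^ 2 / k_f) := by
    intro z
    have h1 : ψ z = ((ψ z).1, 0) + (0, (ψ z).2) := by simp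
    rw [h1, map_add, hfr, hF, mul_comm c]
    congr 1
    change ∑ p, ∑ q, (z.1 p * (A *ᵥ z.1 + z.2 • B) q + (A *ᵥ z.1 + z.2 • B) p * z.1 q) * F p q = _
    generalize A *ᵥ z.1 + z.2 • B = y
    rw [add_mulVec, dotProduct_add]
    simp only [add_mul, Finset.sum_add_distrib, dotProduct, mulVec, Finset.mul_sum,
      Matrix.transpose_apply]
    congr 1
    · refine Finset.sum_congr rfl fun p _ => Finset.sum_congr rfl fun q _ => by ring
    · rw [Finset.sum_comm]
      refine Finset.sum_congr rfl fun p _ => Finset.sum_congr rfl fun q _ => by ring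
  refine ⟨F + Fᵀ, -u0, ?_, by linarith, ?_⟩
  · rw [Matrix.IsSymm, transpose_add, transpose_transpose, add_comm]
  intro x u hxu
  by_cases hz : (x, u) = (0 : (Fin n → ℝ) × ℝ)
  · have : x = 0 := congrArg Prod.fst hz
    simp [this]
  set r := ‖((x, u) : (Fin n → ℝ) × ℝ)‖ with hr
  have hr0 : 0 < r := norm_pos_iff.2 hz
  have hmem : ψ (r⁻¹ • (x, u)) ∈ K := by
    refine ⟨_, ?_, rfl⟩
    rw [mem_sphere_zero_iff_norm, norm_smul, norm_inv, Real.norm_eq_abs, abs_of_pos hr0, ← hr,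
      inv_mul_cancel₀ hr0.ne']
  have h1 := hf1 _ (subset_convexHull ℝ K hmem)
  rw [hfg] at h1
  have h2 : (r⁻¹ • (x, u)).1 ⬝ᵥ ((F + Fᵀ) *ᵥ (A *ᵥ (r⁻¹ • (x, u)).1 + (r⁻¹ • (x, u)).2 • B))
      + c * ((r⁻¹ • (x, u)).2 * (C ⬝ᵥ (r⁻¹ • (x, u)).1) - (r⁻¹ • (x, u)).2 ^ 2 / k_f)
      = (x ⬝ᵥ ((F + Fᵀ) *ᵥ (A *ᵥ x + u • B)) + c * (u * (C ⬝ᵥ x) - u ^ 2 / k_f)) / r ^ 2 := by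
    simp only [Prod.smul_fst, Prod.smul_snd, mulVec_smul, smul_eq_mul, mul_smul, ← smul_add,
      smul_dotProduct, dotProduct_smul]
    field_simp
  rw [h2, div_lt_iff₀ (by positivity)] at h1
  have h3 : ‖x‖ ≤ r := by rw [hr]; exact norm_fst_le (x, u)
  have h4 : ‖x‖ ^ 2 ≤ r ^ 2 := pow_le_pow_left₀ (norm_nonneg _) h3 2
  have h5 := mul_nonneg hc0 hxu
  nlinarith

/-- Lemma 1, circle criterion for incremental stability.
If `A` is Hurwitz and the frequency-domain condition
`Re (C (iωI − A)⁻¹ B) < 1/k_f` holds for all `ω ∈ ℝ`, then there exist a symmetric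
positive definite matrix `P` and `ε > 0` (depending only on `A, B, C, k_f`) such that
for every slope-restricted nonlinearity `h`, every disturbance channel `B_w`, every
continuous disturbance `w` and every pair of solutions `x, xT` of the Lur'e system
`ẋ = A x + B h(C x) + B_w w(t)` on `[0,∞)` with the same disturbance, the quadratic
function `V(t) = (x(t) − xT(t))ᵀ P (x(t) − xT(t))` satisfies `V'(t) ≤ −ε V(t)`. -/
theorem zero_speed_fins_incremental_stability_circle_criterion
    (n : ℕ) (A : Matrix (Fin n) (Fin n) ℝ) (B C : Fin n → ℝ) (k_f : ℝ)
    (hk_f : 0 < k_f)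
    (hHurwitz : ∀ μ ∈ spectrum ℂ (A.map (fun a : ℝ => (a : ℂ))), μ.re < 0)
    (hfreq : ∀ ω : ℝ,
      ((fun i => (C i : ℂ)) ⬝ᵥ
        (((Complex.I * (ω : ℂ)) • (1 : Matrix (Fin n) (Fin n) ℂ)
            - A.map (fun a : ℝ => (a : ℂ)))⁻¹ *ᵥ fun i => (B i : ℂ))).re < 1 / k_f) :
    ∃ (P : Matrix (Fin n) (Fin n) ℝ) (ε : ℝ), P.IsSymm ∧ P.PosDef ∧ 0 < ε ∧
      ∀ h : ℝ → ℝ,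
        (∀ y₁ y₂ : ℝ, 0 ≤ (h y₁ - h y₂) * (y₁ - y₂) ∧
            (h y₁ - h y₂) * (y₁ - y₂) ≤ k_f * (y₁ - y₂) ^ 2) →
        ∀ B_w : Fin n → ℝ, ∀ w : ℝ → ℝ, ContinuousOn w (Ici 0) →
        ∀ x xT : ℝ → Fin n → ℝ,
          (∀ t ∈ Ici (0 : ℝ),
            HasDerivWithinAt x (A *ᵥ x t + h (C ⬝ᵥ x t) • B + w t • B_w) (Ici 0) t) →
          (∀ t ∈ Ici (0 : ℝ),
            HasDerivWithinAt xT (A *ᵥ xT t + h (C ⬝ᵥ xT t) • B + w t • B_w) (Ici 0) t) →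
          ∀ t ∈ Ici (0 : ℝ),
            derivWithin (fun s => (x s - xT s) ⬝ᵥ (P *ᵥ (x s - xT s))) (Ici 0) t ≤
              -ε * ((x t - xT t) ⬝ᵥ (P *ᵥ (x t - xT t))) := by
  obtain ⟨P, δ, hP, hδ, hkyp⟩ := lure_kyp A B C k_f hk_f hHurwitz hfreq
  have hpd : ∀ v : Fin n → ℝ, v ≠ 0 → 0 < v ⬝ᵥ (P *ᵥ v) := by
    intro v hv
    refine lure_posDef A P hHurwitz hP ?_ v hv
    intro y hy
    have h1 := hkyp y 0 (by simp)
    rw [zero_smul, add_zero] at h1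
    have : 0 < ‖y‖ := norm_pos_iff.2 hy
    have : 0 < δ * ‖y‖ ^ 2 := by positivity
    linarith
  set K0 := ∑ p, ∑ q, |P p q| with hK0
  have hK0n : 0 ≤ K0 := Finset.sum_nonneg fun p _ => Finset.sum_nonneg fun q _ => abs_nonneg _
  have hbd : ∀ v : Fin n → ℝ, v ⬝ᵥ (P *ᵥ v) ≤ K0 * ‖v‖ ^ 2 := by
    intro v
    simp only [dotProduct, mulVec, hK0, Finset.mul_sum, Finset.sum_mul]
    refine Finset.sum_le_sum fun p _ => Finset.sum_le_sum fun q _ => ?_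
    calc v p * (P p q * v q) ≤ |v p * (P p q * v q)| := le_abs_self _
      _ = |P p q| * (|v p| * |v q|) := by rw [abs_mul, abs_mul]; ring
      _ ≤ |P p q| * (‖v‖ * ‖v‖) := by
        gcongr
        · exact norm_le_pi_norm v p
        · exact norm_le_pi_norm v q
      _ = |P p q| * ‖v‖ ^ 2 := by ring
  refine ⟨P, 2 * δ / (K0 + 1), hP, ?_, by positivity, ?_⟩
  · refine Matrix.PosDef.of_dotProduct_mulVec_pos ?_ ?_
    · rw [Matrix.IsHermitian, conjTranspose_eq_transpose_of_trivial]; exact hP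
    · intro v hv
      simpa using hpd v hv
  intro h hh B_w w _ x xT hx hxT t ht
  set z := x t - xT t with hz
  set u := h (C ⬝ᵥ x t) - h (C ⬝ᵥ xT t) with hu
  set z' := A *ᵥ z + u • B with hz'
  have hder : HasDerivWithinAt (fun s => x s - xT s) z' (Ici 0) t := by
    refine ((hx t ht).sub (hxT t ht)).congr_deriv ?_
    rw [hz', hz, hu, mulVec_sub, sub_smul]
    abel
  have hcoord := hasDerivWithinAt_pi.1 hder
  have hV : HasDerivWithinAt (fun s => (x s - xT s) ⬝ᵥ (P *ᵥ (x s - xT s)))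
      (z' ⬝ᵥ (P *ᵥ z) + z ⬝ᵥ (P *ᵥ z')) (Ici 0) t := by
    simp only [dotProduct, mulVec]
    rw [← Finset.sum_add_distrib]
    refine HasDerivWithinAt.fun_sum fun i _ => ?_
    refine (hcoord i).mul ?_
    refine HasDerivWithinAt.fun_sum fun j _ => ?_
    exact (hcoord j).const_mul _
  rw [hV.derivWithin (uniqueDiffOn_Ici 0 t ht)]
  have hsymm : z' ⬝ᵥ (P *ᵥ z) = z ⬝ᵥ (P *ᵥ z') := by
    rw [dotProduct_mulVec, ← mulVec_transpose, hP.eq, dotProduct_comm]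
  have hsec : 0 ≤ u * (C ⬝ᵥ z) - u ^ 2 / k_f := by
    obtain ⟨h1, h2⟩ := hh (C ⬝ᵥ x t) (C ⬝ᵥ xT t)
    have hy : C ⬝ᵥ z = C ⬝ᵥ x t - C ⬝ᵥ xT t := by rw [hz, dotProduct_sub]
    rw [← hy, ← hu] at h1 h2
    set y := C ⬝ᵥ z
    by_cases hy0 : y = 0
    · have : u = 0 := by
        rw [hu, sub_eq_zero]
        rw [hy, sub_eq_zero] at hy0
        rw [hy0]
      rw [this]; simp
    · have hy2 : 0 < y ^ 2 := by positivity
      rw [sub_nonneg, div_le_iff₀ hk_f]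
      have h3 : u ^ 2 * y ^ 2 ≤ (u * y * k_f) * y ^ 2 := by nlinarith
      exact le_of_mul_le_mul_right h3 hy2
  have hmain := hkyp z u hsec
  rw [hsymm]
  have h1 := hbd z
  have h2 : 2 * δ / (K0 + 1) * (z ⬝ᵥ (P *ᵥ z)) ≤ 2 * δ * ‖z‖ ^ 2 := by
    rw [div_mul_eq_mul_div, div_le_iff₀ (by positivity)]
    have : z ⬝ᵥ (P *ᵥ z) ≤ (K0 + 1) * ‖z‖ ^ 2 := by nlinarith [sq_nonneg ‖z‖]
    nlinarith
  linarith
end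

section
/- Fix c > 0, n_θ > 0, ω₀ > 0, k_f > 0 and real gains k_p, k_d. Assume the frequency-domain condition Re W̃(iω) + 1/k_f > 0 for all ω ∈ ℝ, where W̃(iω) = iω(k_d·iω + k_p) / ((iω + c)(ω₀² − ω² + 2 n_θ iω)). Then there exist a symmetric positive definite 3×3 real matrix P and ε > 0 such that: for every function h : ℝ → ℝ satisfying the slope restriction with constant k_f, every continuous m_w : [0,∞) → ℝ, and every pair of continuously differentiable solutions (θ, ψ, δ) and (θ̃, ψ̃, δ̃) of the closed-loop system θ' = ψ, ψ' = −ω₀² θ − 2 n_θ ψ + h(−k_p θ − k_d ψ − c δ) + m_w(t), δ' = −c δ − k_p θ − k_d ψ (both with the same m_w), the function V(t) = Δx(t)ᵀ P Δx(t), where Δx = (θ − θ̃, ψ − ψ̃, δ − δ̃), satisfies V'(t) ≤ −ε V(t) for all t ≥ 0. -/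
open Matrix Set

/-- A cubic positive on `[0,∞)` splits as `σ₀ + λ σ₁` with positive definite quadratics. -/
lemma rd_cubic_split (n0 n1 n2 n3 : ℝ) (h3 : 0 < n3)
    (hN : ∀ l : ℝ, 0 ≤ l → 0 < n0 + n1 * l + n2 * l ^ 2 + n3 * l ^ 3) :
    ∃ s0 s1 s2 t0 t1 t2 : ℝ, 0 < s0 ∧ s1 ^ 2 < 4 * s0 * s2 ∧ 0 < t0 ∧ t1 ^ 2 < 4 * t0 * t2 ∧
      n0 = s0 ∧ n1 = s1 + t0 ∧ n2 = s2 + t1 ∧ n3 = t2 := by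
  have hn0 : 0 < n0 := by simpa using hN 0 le_rfl
  obtain ⟨r, hr, hr0⟩ : ∃ r : ℝ, 0 < r ∧ n0 + n1 * (-r) + n2 * (-r) ^ 2 + n3 * (-r) ^ 3 = 0 := by
    set X : ℝ := 1 + (n0 + |n1| + |n2|) / n3 with hX
    have hX1 : 1 ≤ X := by
      have : 0 ≤ (n0 + |n1| + |n2|) / n3 := by positivity
      linarith
    have hXn : n3 * X = n3 + n0 + |n1| + |n2| := by rw [hX]; field_simp; ring
    have hneg : n0 + n1 * (-X) + n2 * (-X) ^ 2 + n3 * (-X) ^ 3 ≤ 0 := by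
      have e : n3 * (-X) ^ 3 = -(n3 + n0 + |n1| + |n2|) * X ^ 2 := by rw [← hXn]; ring
      rw [e]
      have hXX : X ≤ X ^ 2 := by nlinarith
      have a1 : -n1 * X ≤ |n1| * X ^ 2 :=
        calc -n1 * X ≤ |n1| * X := by
              have := neg_le_abs n1
              nlinarith
          _ ≤ |n1| * X ^ 2 := by
              have := abs_nonneg n1
              nlinarith
      have a2 : n2 * X ^ 2 ≤ |n2| * X ^ 2 := by
        have := le_abs_self n2
        nlinarith [sq_nonneg X]
      have a3 : n0 ≤ n0 * X ^ 2 := by nlinarith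
      nlinarith [mul_pos h3 (by positivity : 0 < X ^ 2)]
    have hc : ContinuousOn (fun l : ℝ => n0 + n1 * l + n2 * l ^ 2 + n3 * l ^ 3) (Icc (-X) 0) := by
      fun_prop
    obtain ⟨l, hl, hl0⟩ := intermediate_value_Icc (by linarith : -X ≤ 0) hc
      (show (0 : ℝ) ∈ Icc _ _ from ⟨hneg, by simpa using hn0.le⟩)
    refine ⟨-l, ?_, by simpa using hl0⟩
    rcases hl.2.lt_or_eq with h | h
    · linarith
    · subst h; simp at hl0; linarith
  -- quotient: `q2 = n3`, `q1 = n2 - r n3`, `q0 = n1 - r q1`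
  obtain ⟨q1, hq1⟩ : ∃ q1, q1 = n2 - r * n3 := ⟨_, rfl⟩
  obtain ⟨q0, hq0⟩ : ∃ q0, q0 = n1 - r * q1 := ⟨_, rfl⟩
  have e2 : n2 = q1 + r * n3 := by linarith
  have e1 : n1 = q0 + r * q1 := by linarith
  have e0 : n0 = r * q0 := by
    rw [e1, e2] at hr0
    nlinarith
  have hq0p : 0 < q0 := by
    rw [e0] at hn0
    exact (pos_iff_pos_of_mul_pos hn0).1 hr
  have hq : ∀ l : ℝ, 0 ≤ l → 0 < q0 + q1 * l + n3 * l ^ 2 := by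
    intro l hl
    have := hN l hl
    have e : n0 + n1 * l + n2 * l ^ 2 + n3 * l ^ 3 = (l + r) * (q0 + q1 * l + n3 * l ^ 2) := by
      rw [e0, e1, e2]; ring
    rw [e] at this
    exact (pos_iff_pos_of_mul_pos this).1 (by linarith)
  by_cases h : 0 ≤ q1
  · have hn1 : 0 < n1 := by rw [e1]; positivity
    have hn2 : 0 < n2 := by rw [e2]; positivity
    refine ⟨n0, 0, n2, n1, 0, n3, hn0, ?_, hn1, ?_, rfl, by ring, by ring, rfl⟩
    · have : 0 < 4 * n0 * n2 := by positivity
      simpa using this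
    · have : 0 < 4 * n1 * n3 := by positivity
      simpa using this
  · push Not at h
    have hd : q1 ^ 2 < 4 * q0 * n3 := by
      have := hq (-q1 / (2 * n3)) (div_nonneg (by linarith) (by linarith))
      have e : q0 + q1 * (-q1 / (2 * n3)) + n3 * (-q1 / (2 * n3)) ^ 2
          = (4 * q0 * n3 - q1 ^ 2) / (4 * n3) := by field_simp; ring
      rw [e] at this
      have := (div_pos_iff_of_pos_right (by linarith)).1 this
      linarith
    refine ⟨r * q0, r * q1, r * n3, q0, q1, n3, by positivity, ?_, hq0p, hd, e0, by linarith,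
      by linarith, rfl⟩
    have : 0 < r ^ 2 := by positivity
    nlinarith

/-- Binary positive definite form lower bound. -/
lemma rd_binary (a b d : ℝ) (ha : 0 < a) (h : b ^ 2 < 4 * a * d) :
    ∃ η : ℝ, 0 < η ∧ ∀ x y : ℝ, η * (x ^ 2 + y ^ 2) ≤ a * x ^ 2 + b * x * y + d * y ^ 2 := by
  have hd : 0 < d := by
    by_contra hd
    push Not at hd
    nlinarith [sq_nonneg b]
  refine ⟨(4 * a * d - b ^ 2) / (4 * (a + d)), div_pos (by linarith) (by linarith), ?_⟩
  intro x y
  rw [div_mul_eq_mul_div, div_le_iff₀ (by linarith)]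
  nlinarith [sq_nonneg (2 * a * x + b * y), sq_nonneg (2 * d * y + b * x)]

/-- The polynomial form of the frequency condition. -/
lemma rd_freq (c n_θ ω₀ k_f k_p k_d : ℝ)
    (hc : 0 < c) (hn : 0 < n_θ) (hω₀ : 0 < ω₀)
    (hfreq : ∀ ω : ℝ,
      (Complex.I * (ω : ℂ) * ((k_d : ℂ) * (Complex.I * (ω : ℂ)) + (k_p : ℂ)) /
          ((Complex.I * (ω : ℂ) + (c : ℂ)) *
            ((ω₀ : ℂ) ^ 2 - (ω : ℂ) ^ 2 + 2 * (n_θ : ℂ) * Complex.I * (ω : ℂ)))).re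
        + 1 / k_f > 0) (l : ℝ) (hl : 0 ≤ l) :
    0 < -k_d * l * (c * ω₀ ^ 2 - (c + 2 * n_θ) * l) + k_p * l * (ω₀ ^ 2 + 2 * n_θ * c - l)
      + ((c * ω₀ ^ 2 - (c + 2 * n_θ) * l) ^ 2 + l * (ω₀ ^ 2 + 2 * n_θ * c - l) ^ 2) / k_f := by
  obtain ⟨w, hw⟩ : ∃ w : ℝ, w ^ 2 = l := ⟨√l, Real.sq_sqrt hl⟩
  have h := hfreq w
  have e1 : Complex.I * (w : ℂ) * ((k_d : ℂ) * (Complex.I * (w : ℂ)) + (k_p : ℂ))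
      = ⟨-k_d * w ^ 2, k_p * w⟩ := by
    apply Complex.ext <;> simp [pow_two] <;> ring
  have e2 : (Complex.I * (w : ℂ) + (c : ℂ)) *
            ((ω₀ : ℂ) ^ 2 - (w : ℂ) ^ 2 + 2 * (n_θ : ℂ) * Complex.I * (w : ℂ))
      = ⟨c * ω₀ ^ 2 - (c + 2 * n_θ) * w ^ 2, w * (ω₀ ^ 2 + 2 * n_θ * c - w ^ 2)⟩ := by
    apply Complex.ext <;> simp [pow_two] <;> ring
  rw [e1, e2, Complex.div_re] at h
  simp only [Complex.normSq_mk] at h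
  subst hw
  set A := c * ω₀ ^ 2 - (c + 2 * n_θ) * w ^ 2 with hA
  set B := ω₀ ^ 2 + 2 * n_θ * c - w ^ 2 with hB
  have hD : 0 < A * A + w * B * (w * B) := by
    by_contra hcon
    have hA0 : A = 0 := by nlinarith [mul_self_nonneg A, mul_self_nonneg (w * B)]
    have hB0 : w * B = 0 := by nlinarith [mul_self_nonneg A, mul_self_nonneg (w * B)]
    rcases mul_eq_zero.1 hB0 with h0 | h0
    · rw [hA, h0] at hA0
      have : 0 < c * ω₀ ^ 2 := by positivity
      nlinarith
    · have hw2 : w ^ 2 = ω₀ ^ 2 + 2 * n_θ * c := by linarith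
      rw [hA, hw2] at hA0
      have h1 : 0 < n_θ * ω₀ ^ 2 := by positivity
      have h2 : 0 < (c + 2 * n_θ) * (n_θ * c) := by positivity
      nlinarith
  have := mul_pos h hD
  have e : (-k_d * w ^ 2 * A / (A * A + w * B * (w * B)) +
      k_p * w * (w * B) / (A * A + w * B * (w * B)) + 1 / k_f) * (A * A + w * B * (w * B))
      = -k_d * w ^ 2 * A + k_p * w ^ 2 * B + (A ^ 2 + w ^ 2 * B ^ 2) / k_f := by
    have hne := hD.ne'
    rw [add_mul, add_mul, div_mul_cancel₀ _ hne, div_mul_cancel₀ _ hne]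
    ring
  rw [e] at this
  exact this

set_option maxHeartbeats 4000000 in
/-- LMI, controllable case. -/
lemma rd_lmi_ctrl (c n w k k_p k_d : ℝ) (hk : 0 < k) (hne : c * k_d - k_p ≠ 0)
    (hN : ∀ l : ℝ, 0 ≤ l →
      0 < -k_d * l * (c * w ^ 2 - (c + 2 * n) * l) + k_p * l * (w ^ 2 + 2 * n * c - l)
      + ((c * w ^ 2 - (c + 2 * n) * l) ^ 2 + l * (w ^ 2 + 2 * n * c - l) ^ 2) / k) :
    ∃ a b d e f g η : ℝ, 0 < η ∧ ∀ x y z u : ℝ,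
      2 * ((a * x + b * y + d * z) * y + (b * x + e * y + f * z) * (-(w ^ 2) * x - 2 * n * y + u)
        + (d * x + f * y + g * z) * (-(c * z) - k_p * x - k_d * y))
      ≤ u * (u / k - (-(k_p * x) - k_d * y - c * z)) - η * (x ^ 2 + y ^ 2 + z ^ 2) := by
  obtain ⟨a0, ha0⟩ : ∃ a0, a0 = c * w ^ 2 := ⟨_, rfl⟩
  obtain ⟨a1, ha1⟩ : ∃ a1, a1 = w ^ 2 + 2 * n * c := ⟨_, rfl⟩
  obtain ⟨a2, ha2⟩ : ∃ a2, a2 = c + 2 * n := ⟨_, rfl⟩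
  obtain ⟨κ, hκ⟩ : ∃ κ, κ = 1 / k := ⟨_, rfl⟩
  have hκ0 : 0 < κ := by rw [hκ]; positivity
  obtain ⟨s0, s1, s2, t0, t1, t2, hs0, hs, ht0, ht, E0, E1, E2, E3⟩ :=
    rd_cubic_split (a0 ^ 2 * κ) (-k_d * a0 + k_p * a1 + (a1 ^ 2 - 2 * a0 * a2) * κ)
      (k_d * a2 - k_p + (a2 ^ 2 - 2 * a1) * κ) κ hκ0 (by
        intro l hl
        have := hN l hl
        rw [← ha0, ← ha1, ← ha2, div_eq_mul_one_div, ← hκ] at this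
        nlinarith)
  obtain ⟨η1, hη1, H1⟩ := rd_binary s0 (-s1) s2 hs0 (by simpa using hs)
  obtain ⟨η2, hη2, H2⟩ := rd_binary t0 (-t1) t2 ht0 (by simpa using ht)
  -- coefficients of the storage function in `z` coordinates
  obtain ⟨v00, hv00⟩ : ∃ v, v = (2 * a0 * a1 * κ + a0 * k_p) / 2 := ⟨_, rfl⟩
  obtain ⟨v01, hv01⟩ : ∃ v, v = 2 * a0 * a2 * κ + a0 * k_d + s1 := ⟨_, rfl⟩
  obtain ⟨v02, hv02⟩ : ∃ v, v = 2 * a0 * κ := ⟨_, rfl⟩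
  obtain ⟨v11, hv11⟩ : ∃ v, v = (2 * a1 * a2 * κ + a1 * k_d + a2 * k_p - v02) / 2 := ⟨_, rfl⟩
  obtain ⟨v12, hv12⟩ : ∃ v, v = 2 * a1 * κ + k_p + t1 := ⟨_, rfl⟩
  obtain ⟨v22, hv22⟩ : ∃ v, v = (2 * a2 * κ + k_d) / 2 := ⟨_, rfl⟩
  have key : ∀ z0 z1 z2 u : ℝ,
      (2 * v00 * z0 + v01 * z1 + v02 * z2) * z1 + (v01 * z0 + 2 * v11 * z1 + v12 * z2) * z2
        + (v02 * z0 + v12 * z1 + 2 * v22 * z2) * (u - a2 * z2 - a1 * z1 - a0 * z0)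
      = u * (u * κ + k_p * z1 + k_d * z2)
        - (s0 * z0 ^ 2 + (-s1) * z0 * z2 + s2 * z2 ^ 2)
        - (t0 * z1 ^ 2 + (-t1) * z1 * (u - a2 * z2 - a1 * z1 - a0 * z0)
          + t2 * (u - a2 * z2 - a1 * z1 - a0 * z0) ^ 2) := by
    intro z0 z1 z2 u
    obtain ⟨z3, hz3⟩ : ∃ z3, z3 = u - a2 * z2 - a1 * z1 - a0 * z0 := ⟨_, rfl⟩
    have hu : u = z3 + a2 * z2 + a1 * z1 + a0 * z0 := by linarith
    rw [← hz3, hu, hv00, hv01, hv11, hv02, hv12, hv22]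
    have F0 : s0 = a0 ^ 2 * κ := E0.symm
    have F1 : t0 = -k_d * a0 + k_p * a1 + (a1 ^ 2 - 2 * a0 * a2) * κ - s1 := by linarith
    have F2 : s2 = k_d * a2 - k_p + (a2 ^ 2 - 2 * a1) * κ - t1 := by linarith
    rw [F0, F1, F2, ← E3]
    ring
  obtain ⟨m, hm⟩ : ∃ m, m = 1 / (c * k_d - k_p) := ⟨_, rfl⟩
  have hmm : m * (c * k_d - k_p) = 1 := by rw [hm]; field_simp
  -- `z0 = m (δ + k_d θ)`, `z1 = θ - c z0`, `z2 = ψ - c z1`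
  -- rows: z0 = A0 x + C0 z, z1 = A1 x + C1 z, z2 = A2 x + y + C2 z
  obtain ⟨A0, hA0⟩ : ∃ A, A = m * k_d := ⟨_, rfl⟩
  obtain ⟨A1, hA1⟩ : ∃ A, A = 1 - c * A0 := ⟨_, rfl⟩
  obtain ⟨A2, hA2⟩ : ∃ A, A = -c * A1 := ⟨_, rfl⟩
  obtain ⟨C1, hC1⟩ : ∃ A, A = -c * m := ⟨_, rfl⟩
  obtain ⟨C2, hC2⟩ : ∃ A, A = -c * C1 := ⟨_, rfl⟩
  -- lower bound
  obtain ⟨L, hL⟩ : ∃ L, L = 3 * (1 + c ^ 2 + k_p ^ 2 + k_d ^ 2) := ⟨_, rfl⟩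
  have hLp : 0 < L := by rw [hL]; positivity
  refine ⟨v00 * A0 ^ 2 + v01 * A0 * A1 + v02 * A0 * A2 + v11 * A1 ^ 2 + v12 * A1 * A2 + v22 * A2 ^ 2,
    (v02 * A0 + v12 * A1 + 2 * v22 * A2) / 2,
    (2 * v00 * A0 * m + v01 * (A0 * C1 + A1 * m) + v02 * (A0 * C2 + A2 * m) + 2 * v11 * A1 * C1
      + v12 * (A1 * C2 + A2 * C1) + 2 * v22 * A2 * C2) / 2,
    v22,
    (v02 * m + v12 * C1 + 2 * v22 * C2) / 2,
    v00 * m ^ 2 + v01 * m * C1 + v02 * m * C2 + v11 * C1 ^ 2 + v12 * C1 * C2 + v22 * C2 ^ 2,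
    min η1 η2 / L, by positivity, ?_⟩
  intro x y z u
  obtain ⟨z0, hz0⟩ : ∃ q, q = m * (z + k_d * x) := ⟨_, rfl⟩
  obtain ⟨z1, hz1⟩ : ∃ q, q = x - c * z0 := ⟨_, rfl⟩
  obtain ⟨z2, hz2⟩ : ∃ q, q = y - c * z1 := ⟨_, rfl⟩
  have hx : x = z1 + c * z0 := by linarith
  have hy : y = z2 + c * z1 := by linarith
  have hz : z = -k_p * z0 - k_d * z1 := by
    have : (c * k_d - k_p) * z0 = z + k_d * x := by rw [hz0]; linear_combination (z + k_d * x) * hmm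
    rw [hx] at this; linarith
  have K := key z0 z1 z2 u
  obtain ⟨z3, hz3⟩ : ∃ z3, z3 = u - a2 * z2 - a1 * z1 - a0 * z0 := ⟨_, rfl⟩
  rw [← hz3] at K
  have B1 := H1 z0 z2
  have B2 := H2 z1 z3
  have hlow : min η1 η2 / L * (x ^ 2 + y ^ 2 + z ^ 2) ≤ η1 * (z0 ^ 2 + z2 ^ 2)
      + η2 * (z1 ^ 2 + z3 ^ 2) := by
    have hb : x ^ 2 + y ^ 2 + z ^ 2 ≤ L * (z0 ^ 2 + z1 ^ 2 + z2 ^ 2) := by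
      rw [hx, hy, hz, hL]
      have q1 := sq_nonneg (z1 - c * z0)
      have q2 := sq_nonneg (z2 - c * z1)
      have q3 := sq_nonneg (k_p * z0 - k_d * z1)
      have q4 : 0 ≤ z0 ^ 2 + z1 ^ 2 + z2 ^ 2 := by positivity
      have q5 : 0 ≤ c ^ 2 * (z0 ^ 2 + z1 ^ 2 + 3 * z2 ^ 2) := by positivity
      have q6 : 0 ≤ k_p ^ 2 * (z0 ^ 2 + 3 * z1 ^ 2 + 3 * z2 ^ 2) := by positivity
      have q7 : 0 ≤ k_d ^ 2 * (3 * z0 ^ 2 + z1 ^ 2 + 3 * z2 ^ 2) := by positivity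
      have q8 : 0 ≤ z0 ^ 2 := by positivity
      have q9 : 0 ≤ z1 ^ 2 := by positivity
      have q10 : 0 ≤ z2 ^ 2 := by positivity
      linarith
    have hmin : 0 < min η1 η2 := lt_min hη1 hη2
    calc min η1 η2 / L * (x ^ 2 + y ^ 2 + z ^ 2)
        ≤ min η1 η2 / L * (L * (z0 ^ 2 + z1 ^ 2 + z2 ^ 2)) := by gcongr
      _ = min η1 η2 * (z0 ^ 2 + z2 ^ 2) + min η1 η2 * z1 ^ 2 := by field_simp; ring
      _ ≤ η1 * (z0 ^ 2 + z2 ^ 2) + η2 * z1 ^ 2 := by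
          gcongr
          · exact min_le_left _ _
          · exact min_le_right _ _
      _ ≤ _ := by nlinarith [sq_nonneg z3]
  have hr : u * (u / k - (-(k_p * x) - k_d * y - c * z)) = u * (u * κ + k_p * z1 + k_d * z2) := by
    rw [hκ, hx, hy, hz]; ring
  have r0 : z0 = A0 * x + m * z := by rw [hz0, hA0]; ring
  have r1 : z1 = A1 * x + C1 * z := by rw [hz1, r0, hA1, hC1]; ring
  have r2 : z2 = A2 * x + y + C2 * z := by rw [hz2, r1, hA2, hC2]; ring
  have d0 : z1 = A0 * y + m * (-(c * z) - k_p * x - k_d * y) := by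
    rw [hA0, hz1, hz0]
    linear_combination (-x) * hmm
  have d1 : z2 = A1 * y + C1 * (-(c * z) - k_p * x - k_d * y) := by
    rw [hz2, hA1, hC1, ]
    linear_combination (-c) * d0
  have d2 : z3 = A2 * y + (-(w ^ 2) * x - 2 * n * y + u)
      + C2 * (-(c * z) - k_p * x - k_d * y) := by
    have : z3 = (-(w ^ 2) * x - 2 * n * y + u) - c * z2 := by
      rw [hz3, ha0, ha1, ha2, hx, hy]; ring
    rw [this, hA2, hC2]
    linear_combination (-c) * d1
  have hl : 2 * ((
      (v00 * A0 ^ 2 + v01 * A0 * A1 + v02 * A0 * A2 + v11 * A1 ^ 2 + v12 * A1 * A2 + v22 * A2 ^ 2) * x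
      + ((v02 * A0 + v12 * A1 + 2 * v22 * A2) / 2) * y +
      ((2 * v00 * A0 * m + v01 * (A0 * C1 + A1 * m) + v02 * (A0 * C2 + A2 * m) + 2 * v11 * A1 * C1
      + v12 * (A1 * C2 + A2 * C1) + 2 * v22 * A2 * C2) / 2) * z) * y
      + (((v02 * A0 + v12 * A1 + 2 * v22 * A2) / 2) * x + v22 * y
        + ((v02 * m + v12 * C1 + 2 * v22 * C2) / 2) * z) * (-(w ^ 2) * x - 2 * n * y + u)
      + (((2 * v00 * A0 * m + v01 * (A0 * C1 + A1 * m) + v02 * (A0 * C2 + A2 * m) + 2 * v11 * A1 * C1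
      + v12 * (A1 * C2 + A2 * C1) + 2 * v22 * A2 * C2) / 2) * x
        + ((v02 * m + v12 * C1 + 2 * v22 * C2) / 2) * y
        + (v00 * m ^ 2 + v01 * m * C1 + v02 * m * C2 + v11 * C1 ^ 2 + v12 * C1 * C2 + v22 * C2 ^ 2) * z)
        * (-(c * z) - k_p * x - k_d * y))
      = (2 * v00 * z0 + v01 * z1 + v02 * z2) * z1 + (v01 * z0 + 2 * v11 * z1 + v12 * z2) * z2
        + (v02 * z0 + v12 * z1 + 2 * v22 * z2) * z3 := by
    have gen : ∀ x' y' z' : ℝ, 2 * ((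
      (v00 * A0 ^ 2 + v01 * A0 * A1 + v02 * A0 * A2 + v11 * A1 ^ 2 + v12 * A1 * A2 + v22 * A2 ^ 2) * x
      + ((v02 * A0 + v12 * A1 + 2 * v22 * A2) / 2) * y +
      ((2 * v00 * A0 * m + v01 * (A0 * C1 + A1 * m) + v02 * (A0 * C2 + A2 * m) + 2 * v11 * A1 * C1
      + v12 * (A1 * C2 + A2 * C1) + 2 * v22 * A2 * C2) / 2) * z) * x'
      + (((v02 * A0 + v12 * A1 + 2 * v22 * A2) / 2) * x + v22 * y
        + ((v02 * m + v12 * C1 + 2 * v22 * C2) / 2) * z) * y'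
      + (((2 * v00 * A0 * m + v01 * (A0 * C1 + A1 * m) + v02 * (A0 * C2 + A2 * m) + 2 * v11 * A1 * C1
      + v12 * (A1 * C2 + A2 * C1) + 2 * v22 * A2 * C2) / 2) * x
        + ((v02 * m + v12 * C1 + 2 * v22 * C2) / 2) * y
        + (v00 * m ^ 2 + v01 * m * C1 + v02 * m * C2 + v11 * C1 ^ 2 + v12 * C1 * C2 + v22 * C2 ^ 2) * z)
        * z')
      = (2 * v00 * z0 + v01 * z1 + v02 * z2) * (A0 * x' + m * z')
        + (v01 * z0 + 2 * v11 * z1 + v12 * z2) * (A1 * x' + C1 * z')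
        + (v02 * z0 + v12 * z1 + 2 * v22 * z2) * (A2 * x' + y' + C2 * z') := by
      intro x' y' z'
      rw [r0, r1, r2]; ring
    rw [gen, ← d0, ← d1, ← d2]
  rw [hl, hr, K]
  linarith

set_option maxHeartbeats 4000000 in
/-- LMI, uncontrollable case. -/
lemma rd_lmi_unctrl (c n w k k_d : ℝ) (hc : 0 < c) (hn : 0 < n) (hw : 0 < w) (hk : 0 < k)
    (hN : 0 < k_d + 2 * n / k) :
    ∃ a b d e f g η : ℝ, 0 < η ∧ ∀ x y z u : ℝ,
      2 * ((a * x + b * y + d * z) * y + (b * x + e * y + f * z) * (-(w ^ 2) * x - 2 * n * y + u)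
        + (d * x + f * y + g * z) * (-(c * z) - c * k_d * x - k_d * y))
      ≤ u * (u / k - (-(c * k_d * x) - k_d * y - c * z)) - η * (x ^ 2 + y ^ 2 + z ^ 2) := by
  obtain ⟨p, hp⟩ : ∃ p, p = k_d + 4 * n / k := ⟨_, rfl⟩
  obtain ⟨α, hα, H⟩ := rd_binary (1 / k) (-(4 * n / k)) (2 * n * p) (by positivity) (by
    have : 4 * (1 / k) * (2 * n * p) - (-(4 * n / k)) ^ 2 = 8 * n / k * (k_d + 2 * n / k) := by
      rw [hp]; field_simp; ring
    have h2 : 0 < 8 * n / k * (k_d + 2 * n / k) := by positivity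
    linarith)
  -- small parameter
  obtain ⟨ζ, hζ⟩ : ∃ ζ, ζ = α / (4 * (1 / n + 2 * n / w ^ 2)) := ⟨_, rfl⟩
  have hζ0 : 0 < ζ := by rw [hζ]; positivity
  have hζ1 : ζ * (1 / n + 2 * n / w ^ 2) = α / 4 := by rw [hζ]; field_simp
  obtain ⟨M, hM⟩ : ∃ M, M = c / (2 * α) + 1 := ⟨_, rfl⟩
  have hM0 : 0 < M := by rw [hM]; positivity
  have hMα : (M - 1) * (2 * α) = c := by rw [hM]; field_simp; ring
  -- bound α/4 ... final lower bound constants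
  obtain ⟨μ, hμ⟩ : ∃ μ, μ = min (2 * n * ζ * w ^ 2) (min α (2 * c)) := ⟨_, rfl⟩
  have hμ0 : 0 < μ := by rw [hμ]; positivity
  have m1 : μ ≤ 2 * n * ζ * w ^ 2 := by rw [hμ]; exact min_le_left _ _
  have m2 : μ ≤ α := by rw [hμ]; exact (min_le_right _ _).trans (min_le_left _ _)
  have m3 : μ ≤ 2 * c := by rw [hμ]; exact (min_le_right _ _).trans (min_le_right _ _)
  -- V = p/2 (y²+w²x²) + ζ(y²+w²x²+(y+2nx)²+w²x²) + M (z + k_d x)²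
  refine ⟨p / 2 * w ^ 2 + ζ * (2 * w ^ 2 + 4 * n ^ 2) + M * k_d ^ 2, 2 * n * ζ, M * k_d,
    p / 2 + 2 * ζ, 0, M, μ / (2 * (1 + k_d ^ 2)), by positivity, ?_⟩
  intro x y z u
  obtain ⟨v, hv⟩ : ∃ v, v = z + k_d * x := ⟨_, rfl⟩
  have hz : z = v - k_d * x := by linarith
  have B := H u y
  have hlow : μ / (2 * (1 + k_d ^ 2)) * (x ^ 2 + y ^ 2 + z ^ 2) ≤ μ * (x ^ 2 + y ^ 2 + v ^ 2) := by
    rw [div_mul_eq_mul_div, div_le_iff₀ (by positivity)]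
    have : x ^ 2 + y ^ 2 + z ^ 2 ≤ (x ^ 2 + y ^ 2 + v ^ 2) * (2 * (1 + k_d ^ 2)) := by
      rw [hz]
      nlinarith [sq_nonneg (v + k_d * x), sq_nonneg (k_d * y), sq_nonneg (k_d * v),
        sq_nonneg x, sq_nonneg y, sq_nonneg (k_d * x)]
    calc μ * (x ^ 2 + y ^ 2 + z ^ 2) ≤ μ * ((x ^ 2 + y ^ 2 + v ^ 2) * (2 * (1 + k_d ^ 2))) := by
          gcongr
      _ = _ := by ring
  have hlow2 : μ * (x ^ 2 + y ^ 2 + v ^ 2) ≤ 2 * n * ζ * w ^ 2 * x ^ 2 + α * y ^ 2 + 2 * c * v ^ 2 := by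
    nlinarith [mul_le_mul_of_nonneg_right m1 (sq_nonneg x),
      mul_le_mul_of_nonneg_right m2 (sq_nonneg y), mul_le_mul_of_nonneg_right m3 (sq_nonneg v)]
  -- cross terms
  have c1 : 4 * ζ * u * y ≤ 4 * n * ζ * y ^ 2 + ζ * (1 / n) * u ^ 2 := by
    have : 4 * n * ζ * y ^ 2 + ζ * (1 / n) * u ^ 2 - 4 * ζ * u * y
        = ζ / n * (2 * n * y - u) ^ 2 := by field_simp; ring
    have h2 : 0 ≤ ζ / n * (2 * n * y - u) ^ 2 := by positivity
    linarith
  have c2 : 4 * ζ * n * u * x ≤ 2 * n * ζ * w ^ 2 * x ^ 2 + ζ * (2 * n / w ^ 2) * u ^ 2 := by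
    have : 2 * n * ζ * w ^ 2 * x ^ 2 + ζ * (2 * n / w ^ 2) * u ^ 2 - 4 * ζ * n * u * x
        = 2 * n * ζ / w ^ 2 * (w ^ 2 * x - u) ^ 2 := by field_simp; ring
    have h2 : 0 ≤ 2 * n * ζ / w ^ 2 * (w ^ 2 * x - u) ^ 2 := by positivity
    linarith
  have c3 : -(c * u * v) ≤ α / 2 * u ^ 2 + 2 * c * (M - 1) * v ^ 2 := by
    have : α / 2 * u ^ 2 + 2 * c * (M - 1) * v ^ 2 + c * u * v
        = α / 2 * (u + c / α * v) ^ 2 + c * v ^ 2 * (2 * (M - 1) - c / (2 * α)) := by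
      field_simp; ring
    have h3 : M - 1 = c / (2 * α) := by rw [hM]; ring
    rw [h3] at this
    have h2 : 0 ≤ α / 2 * (u + c / α * v) ^ 2 := by positivity
    have h4 : 0 ≤ c * v ^ 2 * (2 * (c / (2 * α)) - c / (2 * α)) := by
      have : 2 * (c / (2 * α)) - c / (2 * α) = c / (2 * α) := by ring
      rw [this]; positivity
    rw [h3]
    linarith
  have hu : ζ * (1 / n) * u ^ 2 + ζ * (2 * n / w ^ 2) * u ^ 2 = α / 4 * u ^ 2 := by
    rw [← hζ1]; ring
  have hid : u * (u / k - (-(c * k_d * x) - k_d * y - c * z)) -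
      2 * (((p / 2 * w ^ 2 + ζ * (2 * w ^ 2 + 4 * n ^ 2) + M * k_d ^ 2) * x + 2 * n * ζ * y
        + M * k_d * z) * y + (2 * n * ζ * x + (p / 2 + 2 * ζ) * y + 0 * z)
          * (-(w ^ 2) * x - 2 * n * y + u)
        + (M * k_d * x + 0 * y + M * z) * (-(c * z) - c * k_d * x - k_d * y))
      = (1 / k * u ^ 2 + -(4 * n / k) * u * y + 2 * n * p * y ^ 2) + c * u * v
        + 4 * n * ζ * (y ^ 2 + w ^ 2 * x ^ 2) - 4 * ζ * u * y - 4 * ζ * n * u * x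
        + 2 * c * M * v ^ 2 := by
    have : k_d = p - 4 * n / k := by linarith
    rw [hv, this]; ring
  have hu0 : 0 ≤ α * u ^ 2 := by positivity
  linarith

/-- LMI in general. -/
lemma rd_lmi (c n w k k_p k_d : ℝ) (hc : 0 < c) (hn : 0 < n) (hw : 0 < w) (hk : 0 < k)
    (hN : ∀ l : ℝ, 0 ≤ l →
      0 < -k_d * l * (c * w ^ 2 - (c + 2 * n) * l) + k_p * l * (w ^ 2 + 2 * n * c - l)
      + ((c * w ^ 2 - (c + 2 * n) * l) ^ 2 + l * (w ^ 2 + 2 * n * c - l) ^ 2) / k) :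
    ∃ a b d e f g η : ℝ, 0 < η ∧ ∀ x y z u : ℝ,
      2 * ((a * x + b * y + d * z) * y + (b * x + e * y + f * z) * (-(w ^ 2) * x - 2 * n * y + u)
        + (d * x + f * y + g * z) * (-(c * z) - k_p * x - k_d * y))
      ≤ u * (u / k - (-(k_p * x) - k_d * y - c * z)) - η * (x ^ 2 + y ^ 2 + z ^ 2) := by
  by_cases h : c * k_d - k_p = 0
  · have hkp : k_p = c * k_d := by linarith
    subst hkp
    apply rd_lmi_unctrl c n w k k_d hc hn hw hk
    have h1 := hN (w ^ 2) (by positivity)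
    have e : -k_d * w ^ 2 * (c * w ^ 2 - (c + 2 * n) * w ^ 2)
        + c * k_d * w ^ 2 * (w ^ 2 + 2 * n * c - w ^ 2)
        + ((c * w ^ 2 - (c + 2 * n) * w ^ 2) ^ 2 + w ^ 2 * (w ^ 2 + 2 * n * c - w ^ 2) ^ 2) / k
        = (2 * n * w ^ 2 * (w ^ 2 + c ^ 2)) * (k_d + 2 * n / k) := by field_simp; ring
    rw [e] at h1
    exact (pos_iff_pos_of_mul_pos h1).1 (by positivity)
  · exact rd_lmi_ctrl c n w k k_p k_d hk h hN

set_option maxHeartbeats 4000000 in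
/-- Lyapunov positivity. -/
lemma rd_pos (c n w k_p k_d : ℝ) (hc : 0 < c) (hn : 0 < n) (hw : 0 < w)
    (a b d e f g η : ℝ) (hη : 0 < η)
    (H : ∀ x y z : ℝ,
      2 * ((a * x + b * y + d * z) * y + (b * x + e * y + f * z) * (-(w ^ 2) * x - 2 * n * y)
        + (d * x + f * y + g * z) * (-(c * z) - k_p * x - k_d * y))
      ≤ - η * (x ^ 2 + y ^ 2 + z ^ 2)) :
    ∀ x y z : ℝ, (x ≠ 0 ∨ y ≠ 0 ∨ z ≠ 0) →
      0 < x * (a * x + b * y + d * z) + y * (b * x + e * y + f * z) + z * (d * x + f * y + g * z) := by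
  obtain ⟨M, hM⟩ : ∃ M, M = (k_p ^ 2 / w ^ 2 + k_d ^ 2) / (n * c) + 1 := ⟨_, rfl⟩
  have hM0 : 0 < M := by rw [hM]; positivity
  -- comparison function
  let W : ℝ × ℝ × ℝ → ℝ := fun q =>
    M * (q.2.1 ^ 2 + 2 * w ^ 2 * q.1 ^ 2 + (q.2.1 + 2 * n * q.1) ^ 2) + q.2.2 ^ 2
  let V : ℝ × ℝ × ℝ → ℝ := fun q =>
    q.1 * (a * q.1 + b * q.2.1 + d * q.2.2) + q.2.1 * (b * q.1 + e * q.2.1 + f * q.2.2)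
      + q.2.2 * (d * q.1 + f * q.2.1 + g * q.2.2)
  have hWpos : ∀ q, q ≠ 0 → 0 < W q := by
    rintro ⟨x, y, z⟩ hq
    have h1 : 0 ≤ W (x, y, z) := by simp only [W]; positivity
    rcases h1.lt_or_eq with h | h
    · exact h
    · exfalso
      apply hq
      simp only [W] at h
      have i1 : 0 ≤ M * y ^ 2 := by positivity
      have i2 : 0 ≤ M * (2 * w ^ 2 * x ^ 2) := by positivity
      have i3 : 0 ≤ M * (y + 2 * n * x) ^ 2 := by positivity
      have j1 : M * y ^ 2 = 0 := by nlinarith [sq_nonneg z]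
      have j2 : M * (2 * w ^ 2 * x ^ 2) = 0 := by nlinarith [sq_nonneg z]
      have j3 : z ^ 2 = 0 := by nlinarith [sq_nonneg z]
      have k1 : y = 0 := by simpa [hM0.ne'] using j1
      have k2 : x = 0 := by simpa [hM0.ne', hw.ne'] using j2
      have k3 : z = 0 := by simpa using j3
      simp [k1, k2, k3]
  have hVc : Continuous V := by fun_prop
  have hWc : Continuous W := by fun_prop
  have hScompact : IsCompact (Metric.sphere (0 : ℝ × ℝ × ℝ) 1) := isCompact_sphere _ _
  have hSne : (Metric.sphere (0 : ℝ × ℝ × ℝ) 1).Nonempty := by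
    refine ⟨(1, 0, 0), ?_⟩
    simp [Prod.norm_def]
  have hS0 : ∀ q ∈ Metric.sphere (0 : ℝ × ℝ × ℝ) 1, q ≠ 0 := by
    rintro q hq rfl
    simp at hq
  obtain ⟨q, hq, hmin⟩ := hScompact.exists_isMinOn hSne
    (f := fun q => V q / W q) (hVc.continuousOn.div hWc.continuousOn
      (fun q hq => (hWpos q (hS0 q hq)).ne'))
  obtain ⟨m, hm⟩ : ∃ m, m = V q / W q := ⟨_, rfl⟩
  have hq0 : q ≠ 0 := hS0 q hq
  have hVm : V q = m * W q := by
    rw [hm]; field_simp [(hWpos q hq0).ne']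
  have hVsc : ∀ (r : ℝ) (p : ℝ × ℝ × ℝ), V (r • p) = r ^ 2 * V p := by
    intro r p; simp only [V, Prod.smul_fst, Prod.smul_snd, smul_eq_mul]; ring
  have hWsc : ∀ (r : ℝ) (p : ℝ × ℝ × ℝ), W (r • p) = r ^ 2 * W p := by
    intro r p; simp only [W, Prod.smul_fst, Prod.smul_snd, smul_eq_mul]; ring
  have hge : ∀ p, m * W p ≤ V p := by
    intro p
    by_cases hp : p = 0
    · subst hp; simp [V, W]
    · have hnp : 0 < ‖p‖ := norm_pos_iff.2 hp
      have hs : (‖p‖⁻¹ • p) ∈ Metric.sphere (0 : ℝ × ℝ × ℝ) 1 := by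
        simp [norm_smul, hnp.ne']
      have := hmin hs
      simp only [Set.mem_ofPred_eq] at this
      rw [← hm, hVsc, hWsc, mul_div_mul_left _ _ (by positivity), le_div_iff₀ (hWpos p hp)] at this
      exact this
  have hmpos : 0 < m := by
    by_contra hmn
    push Not at hmn
    obtain ⟨x, y, z⟩ := q
    have hH := H x y z
    have hnn : 0 < x ^ 2 + y ^ 2 + z ^ 2 := by
      by_contra hcon
      apply hq0
      have k1 : x = 0 := by nlinarith [sq_nonneg x, sq_nonneg y, sq_nonneg z]
      have k2 : y = 0 := by nlinarith [sq_nonneg x, sq_nonneg y, sq_nonneg z]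
      have k3 : z = 0 := by nlinarith [sq_nonneg x, sq_nonneg y, sq_nonneg z]
      simp [k1, k2, k3]
    obtain ⟨y', hy'⟩ : ∃ y', y' = -(w ^ 2) * x - 2 * n * y := ⟨_, rfl⟩
    obtain ⟨z', hz'⟩ : ∃ z', z' = -(c * z) - k_p * x - k_d * y := ⟨_, rfl⟩
    obtain ⟨DV, hDV⟩ : ∃ DV, DV = 2 * ((a * x + b * y + d * z) * y + (b * x + e * y + f * z) * y'
        + (d * x + f * y + g * z) * z') := ⟨_, rfl⟩
    obtain ⟨DW, hDW⟩ : ∃ DW, DW = 2 * (M * (y * y' + 2 * w ^ 2 * x * y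
        + (y + 2 * n * x) * (y' + 2 * n * y)) + z * z') := ⟨_, rfl⟩
    have hDVneg : DV < 0 := by
      rw [hDV, hy', hz']
      have : 0 < η * (x ^ 2 + y ^ 2 + z ^ 2) := by positivity
      linarith
    have hDWneg : DW ≤ 0 := by
      have e1 : DW = -(4 * n * M * (y ^ 2 + w ^ 2 * x ^ 2)) - 2 * c * z ^ 2
          - 2 * z * (k_p * x + k_d * y) := by
        rw [hDW, hy', hz']; ring
      have c1 : -(2 * z * (k_p * x)) ≤ c * z ^ 2 + k_p ^ 2 * x ^ 2 / c := by
        have : c * z ^ 2 + k_p ^ 2 * x ^ 2 / c + 2 * z * (k_p * x) = (c * z + k_p * x) ^ 2 / c := by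
          field_simp; ring
        have h2 : 0 ≤ (c * z + k_p * x) ^ 2 / c := by positivity
        linarith
      have c2 : -(2 * z * (k_d * y)) ≤ c * z ^ 2 + k_d ^ 2 * y ^ 2 / c := by
        have : c * z ^ 2 + k_d ^ 2 * y ^ 2 / c + 2 * z * (k_d * y) = (c * z + k_d * y) ^ 2 / c := by
          field_simp; ring
        have h2 : 0 ≤ (c * z + k_d * y) ^ 2 / c := by positivity
        linarith
      have c3 : 4 * n * M * (y ^ 2 + w ^ 2 * x ^ 2) - k_p ^ 2 * x ^ 2 / c - k_d ^ 2 * y ^ 2 / c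
          = 3 * k_p ^ 2 * x ^ 2 / c + 3 * k_d ^ 2 * y ^ 2 / c
            + 4 * k_p ^ 2 * y ^ 2 / (w ^ 2 * c) + 4 * k_d ^ 2 * w ^ 2 * x ^ 2 / c
            + 4 * n * (y ^ 2 + w ^ 2 * x ^ 2) := by
        rw [hM]; field_simp; ring
      have c4 : 0 ≤ 3 * k_p ^ 2 * x ^ 2 / c + 3 * k_d ^ 2 * y ^ 2 / c
            + 4 * k_p ^ 2 * y ^ 2 / (w ^ 2 * c) + 4 * k_d ^ 2 * w ^ 2 * x ^ 2 / c
            + 4 * n * (y ^ 2 + w ^ 2 * x ^ 2) := by positivity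
      rw [e1]
      linarith
    -- first-order condition along the direction `(y, y', z')`
    obtain ⟨Q, hQ⟩ : ∃ Q, Q = V (y, y', z') - m * W (y, y', z') := ⟨_, rfl⟩
    have hexp : ∀ t : ℝ, 0 ≤ t * (DV - m * DW) + t ^ 2 * Q := by
      intro t
      have h1 := hge (x + t * y, y + t * y', z + t * z')
      have h2 : V (x + t * y, y + t * y', z + t * z') - m * W (x + t * y, y + t * y', z + t * z')
          = (V (x, y, z) - m * W (x, y, z)) + t * (DV - m * DW) + t ^ 2 * Q := by
        rw [hQ, hDV, hDW]; simp only [V, W]; ring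
      rw [hVm] at h2
      linarith
    have hD : DV - m * DW < 0 := by nlinarith
    have hQ0 : 0 ≤ Q := by rw [hQ]; linarith [hge (y, y', z')]
    have h3 := hexp (-(DV - m * DW) / (2 * (Q + 1)))
    have h4 : -(DV - m * DW) / (2 * (Q + 1)) * (DV - m * DW)
        + (-(DV - m * DW) / (2 * (Q + 1))) ^ 2 * Q
        = -((DV - m * DW) ^ 2 * (Q + 2) / (4 * (Q + 1) ^ 2)) := by field_simp; ring
    rw [h4] at h3
    have h5 : 0 < (DV - m * DW) ^ 2 := by nlinarith
    have h6 : 0 < (DV - m * DW) ^ 2 * (Q + 2) / (4 * (Q + 1) ^ 2) := by positivity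
    linarith
  intro x y z hxyz
  have hne : ((x, y, z) : ℝ × ℝ × ℝ) ≠ 0 := by
    intro h
    simp only [Prod.mk_eq_zero] at h
    tauto
  have h1 := hge (x, y, z)
  have h2 := mul_pos hmpos (hWpos _ hne)
  exact lt_of_lt_of_le h2 h1

set_option maxHeartbeats 4000000 in
/-- Corollary: incremental stability of the closed-loop
roll-damping system. If the frequency-domain condition
`Re W̃(iω) + 1/k_f > 0` holds for all `ω`, where
`W̃(iω) = iω(k_d iω + k_p)/((iω + c)(ω₀² − ω² + 2 n_θ iω))`, then there exist a
symmetric positive definite `3×3` matrix `P` and `ε > 0` such that for every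
slope-restricted nonlinearity `h`, every continuous disturbance `m_w` and every pair
of solutions `(θ, ψ, δ)`, `(θ̃, ψ̃, δ̃)` of the closed-loop system with the same
disturbance, `V(t) = Δx(t)ᵀ P Δx(t)` satisfies `V'(t) ≤ −ε V(t)` on `[0,∞)`. -/
theorem roll_damping_closed_loop_incremental_stability
    (c n_θ ω₀ k_f k_p k_d : ℝ)
    (hc : 0 < c) (hn : 0 < n_θ) (hω₀ : 0 < ω₀) (hk_f : 0 < k_f)
    (hfreq : ∀ ω : ℝ,
      (Complex.I * (ω : ℂ) * ((k_d : ℂ) * (Complex.I * (ω : ℂ)) + (k_p : ℂ)) /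
          ((Complex.I * (ω : ℂ) + (c : ℂ)) *
            ((ω₀ : ℂ) ^ 2 - (ω : ℂ) ^ 2 + 2 * (n_θ : ℂ) * Complex.I * (ω : ℂ)))).re
        + 1 / k_f > 0) :
    ∃ (P : Matrix (Fin 3) (Fin 3) ℝ) (ε : ℝ), P.IsSymm ∧ P.PosDef ∧ 0 < ε ∧
      ∀ h : ℝ → ℝ,
        (∀ y₁ y₂ : ℝ, 0 ≤ (h y₁ - h y₂) * (y₁ - y₂) ∧
            (h y₁ - h y₂) * (y₁ - y₂) ≤ k_f * (y₁ - y₂) ^ 2) →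
        ∀ m_w : ℝ → ℝ, ContinuousOn m_w (Ici 0) →
        ∀ θ ψ δ θT ψT δT : ℝ → ℝ,
          (∀ t ∈ Ici (0 : ℝ), HasDerivWithinAt θ (ψ t) (Ici 0) t) →
          (∀ t ∈ Ici (0 : ℝ),
            HasDerivWithinAt ψ
              (-(ω₀ ^ 2) * θ t - 2 * n_θ * ψ t
                + h (-(k_p * θ t) - k_d * ψ t - c * δ t) + m_w t) (Ici 0) t) →
          (∀ t ∈ Ici (0 : ℝ),
            HasDerivWithinAt δ (-(c * δ t) - k_p * θ t - k_d * ψ t) (Ici 0) t) →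
          (∀ t ∈ Ici (0 : ℝ), HasDerivWithinAt θT (ψT t) (Ici 0) t) →
          (∀ t ∈ Ici (0 : ℝ),
            HasDerivWithinAt ψT
              (-(ω₀ ^ 2) * θT t - 2 * n_θ * ψT t
                + h (-(k_p * θT t) - k_d * ψT t - c * δT t) + m_w t) (Ici 0) t) →
          (∀ t ∈ Ici (0 : ℝ),
            HasDerivWithinAt δT (-(c * δT t) - k_p * θT t - k_d * ψT t) (Ici 0) t) →
          ∀ t ∈ Ici (0 : ℝ),
            derivWithin
                (fun s =>
                  ![θ s - θT s, ψ s - ψT s, δ s - δT s] ⬝ᵥ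
                    (P *ᵥ ![θ s - θT s, ψ s - ψT s, δ s - δT s])) (Ici 0) t ≤
              -ε * (![θ t - θT t, ψ t - ψT t, δ t - δT t] ⬝ᵥ
                (P *ᵥ ![θ t - θT t, ψ t - ψT t, δ t - δT t])) := by
  obtain ⟨a, b, d, e, f, g, η, hη, H⟩ := rd_lmi c n_θ ω₀ k_f k_p k_d hc hn hω₀ hk_f
    (rd_freq c n_θ ω₀ k_f k_p k_d hc hn hω₀ hfreq)
  have hpos := rd_pos c n_θ ω₀ k_p k_d hc hn hω₀ a b d e f g η hη (by
    intro x y z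
    have := H x y z 0
    simp only [add_zero, zero_mul] at this
    linarith)
  have hquad : ∀ x y z : ℝ, ![x, y, z] ⬝ᵥ (!![a, b, d; b, e, f; d, f, g] *ᵥ ![x, y, z])
      = x * (a * x + b * y + d * z) + y * (b * x + e * y + f * z) + z * (d * x + f * y + g * z) := by
    intro x y z
    simp [Matrix.mulVec, dotProduct, Fin.sum_univ_three]
  obtain ⟨K, hK⟩ : ∃ K, K = 2 * (|a| + |b| + |d| + |e| + |f| + |g|) + 1 := ⟨_, rfl⟩
  have hK0 : 0 < K := by rw [hK]; positivity
  have hVK : ∀ x y z : ℝ, x * (a * x + b * y + d * z) + y * (b * x + e * y + f * z)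
      + z * (d * x + f * y + g * z) ≤ K * (x ^ 2 + y ^ 2 + z ^ 2) := by
    intro x y z
    have sq : ∀ r s : ℝ, r * s ^ 2 ≤ |r| * s ^ 2 := fun r s =>
      mul_le_mul_of_nonneg_right (le_abs_self r) (sq_nonneg s)
    have cr : ∀ r s t : ℝ, 2 * r * (s * t) ≤ |r| * (s ^ 2 + t ^ 2) := by
      intro r s t
      have h1 := mul_nonneg (sub_nonneg.2 (le_abs_self r)) (sq_nonneg (s + t))
      have h2 := mul_nonneg (sub_nonneg.2 (neg_le_abs r)) (sq_nonneg (s - t))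
      nlinarith
    have p1 := mul_nonneg (abs_nonneg a) (add_nonneg (sq_nonneg y) (sq_nonneg z))
    have p2 := mul_nonneg (abs_nonneg e) (add_nonneg (sq_nonneg x) (sq_nonneg z))
    have p3 := mul_nonneg (abs_nonneg g) (add_nonneg (sq_nonneg x) (sq_nonneg y))
    have p4 := mul_nonneg (abs_nonneg b) (sq_nonneg z)
    have p5 := mul_nonneg (abs_nonneg d) (sq_nonneg y)
    have p6 := mul_nonneg (abs_nonneg f) (sq_nonneg x)
    have p7 : 0 ≤ (|a| + |b| + |d| + |e| + |f| + |g|) * (x ^ 2 + y ^ 2 + z ^ 2) := by positivity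
    have := sq a x
    have := sq e y
    have := sq g z
    have := cr b x y
    have := cr d x z
    have := cr f y z
    rw [hK]
    nlinarith [sq_nonneg x, sq_nonneg y, sq_nonneg z]
  have hsymm : (!![a, b, d; b, e, f; d, f, g] : Matrix (Fin 3) (Fin 3) ℝ).IsSymm := by
    ext i j
    fin_cases i <;> fin_cases j <;> rfl
  refine ⟨!![a, b, d; b, e, f; d, f, g], η / K, hsymm, ?_, by positivity, ?_⟩
  · refine Matrix.PosDef.of_dotProduct_mulVec_pos ?_ ?_
    · rw [Matrix.IsHermitian, Matrix.conjTranspose_eq_transpose_of_trivial]; exact hsymm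
    · intro v hv
      have hv3 : v = ![v 0, v 1, v 2] := by
        ext i; fin_cases i <;> rfl
      rw [star_trivial, hv3, hquad]
      apply hpos
      by_contra hcon
      push Not at hcon
      apply hv
      rw [hv3, hcon.1, hcon.2.1, hcon.2.2]
      ext i; fin_cases i <;> rfl
  · intro h hh m_w _ θ ψ δ θT ψT δT h1 h2 h3 h4 h5 h6 t ht
    simp only [hquad]
    have D1 := (h1 t ht).sub (h4 t ht)
    have D2 := (h2 t ht).sub (h5 t ht)
    have D3 := (h3 t ht).sub (h6 t ht)
    have D := ((D1.mul (((D1.const_mul a).add (D2.const_mul b)).add (D3.const_mul d))).add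
      (D2.mul (((D1.const_mul b).add (D2.const_mul e)).add (D3.const_mul f)))).add
      (D3.mul (((D1.const_mul d).add (D2.const_mul f)).add (D3.const_mul g)))
    have hd := D.derivWithin (uniqueDiffOn_Ici (0 : ℝ) t ht)
    have hfun : (fun s => (θ s - θT s) * (a * (θ s - θT s) + b * (ψ s - ψT s) + d * (δ s - δT s))
        + (ψ s - ψT s) * (b * (θ s - θT s) + e * (ψ s - ψT s) + f * (δ s - δT s))
        + (δ s - δT s) * (d * (θ s - θT s) + f * (ψ s - ψT s) + g * (δ s - δT s))) = _ := rfl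
    refine (le_of_eq hd).trans ?_
    clear hd D D1 D2 D3 hfun
    simp only [Pi.sub_apply, Pi.add_apply]
    obtain ⟨y1, hy1⟩ : ∃ q, q = -(k_p * θ t) - k_d * ψ t - c * δ t := ⟨_, rfl⟩
    obtain ⟨y2, hy2⟩ : ∃ q, q = -(k_p * θT t) - k_d * ψT t - c * δT t := ⟨_, rfl⟩
    rw [← hy1, ← hy2]
    obtain ⟨x, hx⟩ : ∃ q, q = θ t - θT t := ⟨_, rfl⟩
    obtain ⟨y, hy⟩ : ∃ q, q = ψ t - ψT t := ⟨_, rfl⟩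
    obtain ⟨z, hz⟩ : ∃ q, q = δ t - δT t := ⟨_, rfl⟩
    obtain ⟨u, hu⟩ : ∃ q, q = h y1 - h y2 := ⟨_, rfl⟩
    have hyy : y1 - y2 = -(k_p * x) - k_d * y - c * z := by rw [hy1, hy2, hx, hy, hz]; ring
    have hdp : -(ω₀ ^ 2) * θ t - 2 * n_θ * ψ t + h y1 + m_w t
        - (-(ω₀ ^ 2) * θT t - 2 * n_θ * ψT t + h y2 + m_w t)
        = -(ω₀ ^ 2) * x - 2 * n_θ * y + u := by rw [hx, hy, hu]; ring
    have hdd : -(c * δ t) - k_p * θ t - k_d * ψ t - (-(c * δT t) - k_p * θT t - k_d * ψT t)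
        = -(c * z) - k_p * x - k_d * y := by rw [hx, hy, hz]; ring
    rw [hdp, hdd, ← hx, ← hy, ← hz]
    have hs := hh y1 y2
    rw [← hu, hyy] at hs
    have hL := H x y z u
    have hsec : u * (u / k_f - (-(k_p * x) - k_d * y - c * z)) ≤ 0 := by
      obtain ⟨Y, hY⟩ : ∃ Y, Y = -(k_p * x) - k_d * y - c * z := ⟨_, rfl⟩
      rw [← hY] at hs ⊢
      by_cases hY0 : Y = 0
      · have : y1 = y2 := by rw [← hY, hY0] at hyy; linarith
        rw [hu, this]; simp
      · have hY2 : 0 < Y ^ 2 := by positivity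
        have e1 : u * (u / k_f - Y) = (u * Y) * (u * Y - k_f * Y ^ 2) / (k_f * Y ^ 2) := by
          field_simp
        rw [e1]
        apply div_nonpos_of_nonpos_of_nonneg
        · exact mul_nonpos_of_nonneg_of_nonpos hs.1 (by linarith [hs.2])
        · positivity
    have hV := hVK x y z
    have hfin : η / K * (x * (a * x + b * y + d * z) + y * (b * x + e * y + f * z)
      + z * (d * x + f * y + g * z)) ≤ η * (x ^ 2 + y ^ 2 + z ^ 2) := by
      calc _ ≤ η / K * (K * (x ^ 2 + y ^ 2 + z ^ 2)) := by gcongr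
        _ = _ := by field_simp
    linarith
end

section
/- Let A be an n×n real Hurwitz matrix, B ∈ ℝⁿ a column vector, C a row covector on ℝⁿ, and k_f > 0, and assume Re( C (iωI − A)⁻¹ B ) < 1/k_f for all ω ∈ ℝ. Then there exist constants C₁ ≥ 1 and ε > 0, depending only on A, B, C and k_f, such that for every function h : ℝ → ℝ satisfying the slope restriction with constant k_f and with h(0) = 0: (a) every continuously differentiable solution x : [0,∞) → ℝⁿ of ẋ = A x + B h(C x) satisfies ‖x(t)‖ ≤ C₁ e^{−εt} ‖x(0)‖ for all t ≥ 0; and (b) x* = 0 is the unique point of ℝⁿ with A x* + B h(C x*) = 0. -/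
open Matrix Set

theorem lur_isometry_diag {E : Type*} [NormedAddCommGroup E] [InnerProductSpace ℂ E]
    [FiniteDimensional ℂ E] (U : E →ₗᵢ[ℂ] E) {m : ℕ} (hm : Module.finrank ℂ E = m) :
    ∃ (b : OrthonormalBasis (Fin m) ℂ E) (l : Fin m → ℂ), ∀ j, U (b j) = l j • b j := by
  classical
  set T : Module.End ℂ E := U.toLinearMap with hT
  have hTU : ∀ v, T v = U v := fun v => rfl
  have hnorm : ∀ (μ : ℂ) (v : E), U v = μ • v → v ≠ 0 → ‖μ‖ = 1 := by
    intro μ v h hv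
    have := U.norm_map v
    rw [h, norm_smul] at this
    have hv' : ‖v‖ ≠ 0 := by simpa using hv
    field_simp at this
    exact this
  have horth : OrthogonalFamily ℂ (fun μ => Module.End.eigenspace T μ)
      fun μ => (Module.End.eigenspace T μ).subtypeₗᵢ := by
    rintro μ ν hμν ⟨v, hv⟩ ⟨w, hw⟩
    by_cases hv' : v = 0
    · simp [hv']
    rw [Module.End.mem_eigenspace_iff, hTU] at hv hw
    have h1 := U.inner_map_map v w
    have hn := hnorm μ v hv hv'
    have hc : μ * (starRingEnd ℂ) μ = 1 := by
      rw [Complex.mul_conj, Complex.normSq_eq_norm_sq, hn]; simp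
    rw [hv, hw, inner_smul_left, inner_smul_right] at h1
    show inner ℂ v w = 0
    by_contra h0
    apply hμν
    have h2 : (starRingEnd ℂ) μ * ν = 1 := by
      have : ((starRingEnd ℂ) μ * ν - 1) * inner ℂ v w = 0 := by linear_combination h1
      rcases mul_eq_zero.1 this with h | h
      · linear_combination h
      · exact absurd h h0
    linear_combination ν * hc - μ * h2
  have hinv : ∀ v ∈ (⨆ μ, Module.End.eigenspace T μ)ᗮ, T v ∈ (⨆ μ, Module.End.eigenspace T μ)ᗮ := by
    rw [← Submodule.iInf_orthogonal]
    refine T.iInf_invariant ?_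
    intro μ v hv w hw
    by_cases hw0 : w = 0
    · simp [hw0]
    have hw' : U w = μ • w := by rwa [Module.End.mem_eigenspace_iff, hTU] at hw
    have hn := hnorm μ w hw' hw0
    have hμ : μ ≠ 0 := by rintro rfl; simp at hn
    have h1 := U.inner_map_map w v
    rw [hw', inner_smul_left, hv w hw] at h1
    have : (starRingEnd ℂ) μ ≠ 0 := by simpa using hμ
    exact (mul_eq_zero.1 h1).resolve_left this
  have hbot : (⨆ μ, Module.End.eigenspace T μ)ᗮ = ⊥ := by
    by_contra hne
    set p := (⨆ μ, Module.End.eigenspace T μ)ᗮ with hp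
    have : Nontrivial p := Submodule.nontrivial_iff_ne_bot.2 hne
    obtain ⟨μ, hμ⟩ := Module.End.exists_eigenvalue (T.restrict hinv)
    apply hμ
    refine Module.End.eigenspace_restrict_eq_bot hinv ?_
    have H₂ : Module.End.eigenspace T μ ⟂ p :=
      (Submodule.isOrtho_orthogonal_right _).mono_left (le_iSup _ _)
    exact H₂.disjoint
  have hbot' : (⨆ μ : Module.End.Eigenvalues T, Module.End.eigenspace T μ)ᗮ = ⊥ :=
    show (⨆ μ : { μ // Module.End.eigenspace T μ ≠ ⊥ }, Module.End.eigenspace T μ)ᗮ = ⊥ by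
      rw [iSup_ne_bot_subtype, hbot]
  have horth' : OrthogonalFamily ℂ (fun μ : Module.End.Eigenvalues T => Module.End.eigenspace T μ)
      fun μ => (Module.End.eigenspace T μ).subtypeₗᵢ := horth.comp Subtype.coe_injective
  have hinternal : DirectSum.IsInternal
      fun μ : Module.End.Eigenvalues T => Module.End.eigenspace T μ :=
    horth'.isInternal_iff.mpr hbot'
  refine ⟨hinternal.subordinateOrthonormalBasis hm horth',
    fun j => (hinternal.subordinateOrthonormalBasisIndex hm j horth').1, fun j => ?_⟩
  have := hinternal.subordinateOrthonormalBasis_subordinate hm j horth'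
  rwa [Module.End.mem_eigenspace_iff] at this

theorem lur_compact_convexHull {E : Type*} [NormedAddCommGroup E] [NormedSpace ℝ E]
    [FiniteDimensional ℝ E] {s : Set E} (hs : IsCompact s) : IsCompact (convexHull ℝ s) := by
  classical
  rcases s.eq_empty_or_nonempty with rfl | ⟨s0, hs0⟩
  · simp
  set N := Module.finrank ℝ E + 1
  set K : Set ((Fin N → ℝ) × (Fin N → E)) :=
    (stdSimplex ℝ (Fin N)) ×ˢ (Set.pi univ fun _ => s)
  have hK : IsCompact K := (isCompact_stdSimplex ℝ (Fin N)).prod (isCompact_univ_pi fun _ => hs)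
  have hc : Continuous fun p : (Fin N → ℝ) × (Fin N → E) => ∑ i, p.1 i • p.2 i := by fun_prop
  convert! hK.image hc using 1
  ext y
  constructor
  · intro hy
    obtain ⟨ι, hι, z, w, hz, hz2, hw, hw1, rfl⟩ := eq_pos_convex_span_of_mem_convexHull hy
    have hcard : Fintype.card ι ≤ N := by
      refine hz2.card_le_finrank_succ.trans ?_
      have := Submodule.finrank_le (vectorSpan ℝ (Set.range z))
      omega
    obtain ⟨e⟩ : Nonempty (ι ↪ Fin N) := by
      apply Function.Embedding.nonempty_of_card_le; simpa using hcard
    have key : ∀ {M : Type _} [AddCommMonoid M] (f : ι → M) (g : Fin N → M), (∀ i, g (e i) = f i) →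
        (∀ j, j ∉ Set.range e → g j = 0) → ∑ j, g j = ∑ i, f i := by
      intro M _ f g h1 h2
      rw [← Finset.sum_subset (Finset.subset_univ (Finset.univ.map e))]
      · simp [h1]
      · intro j _ hj; apply h2; simpa using hj
    have key2 : ∀ (f : ι → ℝ) (g : Fin N → ℝ), (∀ i, g (e i) = f i) →
        (∀ j, j ∉ Set.range e → g j = 0) → ∑ j, g j = ∑ i, f i := by
      intro f g h1 h2
      rw [← Finset.sum_subset (Finset.subset_univ (Finset.univ.map e))]
      · simp [h1]
      · intro j _ hj; apply h2; simpa using hj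
    have hei : Function.Injective e := e.injective
    refine ⟨(Function.extend e w 0, Function.extend e z fun _ => s0), ⟨⟨?_, ?_⟩, ?_⟩, ?_⟩
    · intro j
      by_cases hj : ∃ i, e i = j
      · obtain ⟨i, rfl⟩ := hj
        simp [hei.extend_apply, (hw i).le]
      · simp [Function.extend_apply' _ _ _ hj]
    · rw [← hw1]
      apply key2
      · intro i; simp [hei.extend_apply]
      · intro j hj; simp [Function.extend_apply' w (0 : Fin N → ℝ) j hj]
    · intro j _
      by_cases hj : ∃ i, e i = j
      · obtain ⟨i, rfl⟩ := hj
        simp only [hei.extend_apply]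
        exact hz ⟨i, rfl⟩
      · simpa [Function.extend_apply' _ _ _ hj] using hs0
    · apply key
      · intro i; simp [hei.extend_apply]
      · intro j hj; simp [Function.extend_apply' w (0 : Fin N → ℝ) j hj]
  · rintro ⟨⟨w, z⟩, ⟨hw, hz⟩, rfl⟩
    exact (convex_convexHull ℝ s).sum_mem (fun i _ => hw.1 i) hw.2
      (fun i _ => subset_convexHull ℝ s (hz i (mem_univ i)))

theorem lur_pencil {n : ℕ} {ι : Type} [Fintype ι] (X F : Matrix (Fin n) ι ℂ)
    (h : F * Xᴴ + X * Fᴴ = 0) :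
    ∃ (m : ℕ) (b : OrthonormalBasis (Fin m) ℂ (EuclideanSpace ℂ ι)), ∀ j,
      X *ᵥ (b j).ofLp = 0 ∨ ∃ ω : ℝ, F *ᵥ (b j).ofLp = (Complex.I * ω) • (X *ᵥ (b j).ofLp) := by
  classical
  set a := toEuclideanLin (F + X)ᴴ with ha
  set c := toEuclideanLin (F - X)ᴴ with hc
  have hin : ∀ (G : Matrix (Fin n) ι ℂ) (v : EuclideanSpace ℂ (Fin n)) (w : EuclideanSpace ℂ ι),
      inner ℂ (toEuclideanLin Gᴴ v) w = inner ℂ v (toEuclideanLin G w) := by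
    intro G v w
    rw [toEuclideanLin_conjTranspose_eq_adjoint, LinearMap.adjoint_inner_left]
  have hGG : (F + X) * (F + X)ᴴ = (F - X) * (F - X)ᴴ := by
    simp only [conjTranspose_add, conjTranspose_sub, Matrix.add_mul, Matrix.mul_add,
      Matrix.sub_mul, Matrix.mul_sub]
    have h2 : F * Xᴴ = - (X * Fᴴ) := eq_neg_of_add_eq_zero_left h
    rw [h2]; abel
  have hna : ∀ v, ‖a v‖ = ‖c v‖ := by
    intro v
    have h1 : inner ℂ (a v) (a v) = inner ℂ (c v) (c v) := by
      rw [ha, hc, hin, hin]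
      congr 1
      have := congrArg (fun M => toEuclideanLin M v) hGG
      simpa [toLpLin_apply, Matrix.mulVec_mulVec] using this
    rw [inner_self_eq_norm_sq_to_K, inner_self_eq_norm_sq_to_K] at h1
    have h2 : ‖a v‖ ^ 2 = ‖c v‖ ^ 2 := by exact_mod_cast h1
    exact (sq_eq_sq₀ (norm_nonneg _) (norm_nonneg _)).1 h2
  have hker : LinearMap.ker a.rangeRestrict ≤ LinearMap.ker c := by
    intro v hv
    rw [LinearMap.ker_rangeRestrict, LinearMap.mem_ker] at hv
    rw [LinearMap.mem_ker, ← norm_eq_zero, ← hna, hv, norm_zero]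
  obtain ⟨L, hL⟩ : ∃ L : LinearMap.range a →ₗ[ℂ] EuclideanSpace ℂ ι,
      ∀ v, L (a.rangeRestrict v) = c v := by
    obtain ⟨g, hg⟩ := a.rangeRestrict.exists_rightInverse_of_surjective (LinearMap.range_rangeRestrict a)
    refine ⟨c ∘ₗ g, fun v => ?_⟩
    have : g (a.rangeRestrict v) - v ∈ LinearMap.ker a.rangeRestrict := by
      rw [LinearMap.mem_ker, map_sub, sub_eq_zero]
      exact congrArg (fun f => f (a.rangeRestrict v)) hg
    have := hker this
    rw [LinearMap.mem_ker, map_sub, sub_eq_zero] at this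
    exact this
  let L' : LinearMap.range a →ₗᵢ[ℂ] EuclideanSpace ℂ ι := ⟨L, by
    rintro ⟨_, v, rfl⟩
    have := hL v
    change L ⟨a v, _⟩ = c v at this
    rw [this, ← hna]; rfl⟩
  obtain ⟨b, l, hbl⟩ := lur_isometry_diag L'.extend (m := _) rfl
  refine ⟨_, b, fun j => ?_⟩
  have hU : ∀ v, L'.extend (a v) = c v := by
    intro v
    have := L'.extend_apply (a.rangeRestrict v)
    exact this.trans (hL v)
  have hln : ‖l j‖ = 1 := by
    have := L'.extend.norm_map (b j)
    rw [hbl, norm_smul] at this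
    simpa using this
  have heq : toEuclideanLin (F + X) (b j) = l j • toEuclideanLin (F - X) (b j) := by
    refine ext_inner_left ℂ fun v => ?_
    rw [← hin, inner_smul_right, ← hin]
    rw [← L'.extend.inner_map_map, hbl]
    erw [hU]
    rw [inner_smul_right]
  have heq2 : F *ᵥ (b j).ofLp + X *ᵥ (b j).ofLp = l j • (F *ᵥ (b j).ofLp - X *ᵥ (b j).ofLp) := by
    have := congrArg WithLp.ofLp heq
    simpa [toLpLin_apply, Matrix.add_mulVec, Matrix.sub_mulVec] using this
  by_cases h1 : l j = 1
  · left
    rw [h1] at heq2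
    funext i
    have := congrFun heq2 i
    simp at this ⊢
    linear_combination this / 2
  · right
    have h1' : l j - 1 ≠ 0 := sub_ne_zero.2 h1
    refine ⟨((1 + l j) / (l j - 1)).im, ?_⟩
    have hre : ((1 + l j) / (l j - 1)).re = 0 := by
      rw [Complex.div_re]
      have : (l j).re ^ 2 + (l j).im ^ 2 = 1 := by
        have := Complex.sq_norm (l j)
        rw [hln, Complex.normSq_apply] at this
        linarith
      simp only [Complex.add_re, Complex.one_re, Complex.sub_re, Complex.add_im, Complex.one_im,
        Complex.sub_im]
      rw [← add_div]
      have : (1 + (l j).re) * ((l j).re - 1) + (0 + (l j).im) * ((l j).im - 0) = 0 := by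
        linarith
      rw [this, zero_div]
    have hI : Complex.I * (((1 + l j) / (l j - 1)).im : ℂ) = (1 + l j) / (l j - 1) := by
      apply Complex.ext <;> simp [hre]
    rw [hI]
    funext i
    have := congrFun heq2 i
    simp at this ⊢
    field_simp
    linear_combination -this

/-- The matrix `f xᴴ + x fᴴ`. -/
def lurPhi {n : ℕ} (x f : Fin n → ℂ) : Fin n → Fin n → ℂ :=
  fun i j => f i * (starRingEnd ℂ) (x j) + x i * (starRingEnd ℂ) (f j)

/-- The supply rate. -/
def lurSigma {n : ℕ} (c : Fin n → ℂ) (κ : ℝ) (x : Fin n → ℂ) (u : ℂ) : ℝ :=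
  ((starRingEnd ℂ) u * (c ⬝ᵥ x - κ * u)).re

theorem lur_parseval {ι : Type} [Fintype ι] {m : ℕ}
    (b : OrthonormalBasis (Fin m) ℂ (EuclideanSpace ℂ ι)) (u y : ι → ℂ) :
    ∑ j, (starRingEnd ℂ) (u j) * y j =
      ∑ k, (starRingEnd ℂ) (u ⬝ᵥ (b k).ofLp) * (y ⬝ᵥ (b k).ofLp) := by
  have h := b.sum_inner_mul_inner (WithLp.toLp 2 (star y)) (WithLp.toLp 2 (star u))
  simp only [EuclideanSpace.inner_eq_star_dotProduct, star_star] at h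
  have e : ∀ k, (starRingEnd ℂ) (u ⬝ᵥ (b k).ofLp) = star u ⬝ᵥ star (b k).ofLp := by
    intro k
    simp [dotProduct, map_sum]
  simp only [e]
  rw [show (∑ j, (starRingEnd ℂ) (u j) * y j) = star u ⬝ᵥ y by simp [dotProduct], ← h]
  refine Finset.sum_congr rfl fun k _ => ?_
  rw [dotProduct_comm y, mul_comm]

theorem lur_disjoint {n : ℕ} (M : Matrix (Fin n) (Fin n) ℂ) (b c : Fin n → ℂ) (κ : ℝ) (hκ : 0 < κ)
    (hneg : ∀ (ω : ℝ) (x : Fin n → ℂ) (u : ℂ), M *ᵥ x + u • b = (Complex.I * ω) • x →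
      (x ≠ 0 ∨ u ≠ 0) → lurSigma c κ x u < 0)
    {ι : Type} [Fintype ι] (x : ι → Fin n → ℂ) (u : ι → ℂ)
    (h0 : ∑ j, lurPhi (x j) (M *ᵥ x j + u j • b) = 0)
    (hs : 0 ≤ ∑ j, lurSigma c κ (x j) (u j)) (j : ι) : x j = 0 ∧ u j = 0 := by
  set X : Matrix (Fin n) ι ℂ := Matrix.of fun i j => x j i with hX
  set F : Matrix (Fin n) ι ℂ := Matrix.of fun i j => (M *ᵥ x j + u j • b) i with hF
  have hFX : F * Xᴴ + X * Fᴴ = 0 := by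
    ext i k
    have := congrFun (congrFun h0 i) k
    simp only [Finset.sum_apply, lurPhi, Finset.sum_add_distrib] at this
    simpa [Matrix.mul_apply, hX, hF] using this
  obtain ⟨m, v, hv⟩ := lur_pencil X F hFX
  have hFv : ∀ w : ι → ℂ, F *ᵥ w = M *ᵥ (X *ᵥ w) + (u ⬝ᵥ w) • b := by
    intro w
    have : F = M * X + Matrix.vecMulVec b u := by
      ext i j
      simp [hF, hX, Matrix.mul_apply, Matrix.mulVec, dotProduct, Matrix.vecMulVec_apply, mul_comm]
    rw [this, Matrix.add_mulVec, Matrix.mulVec_mulVec, Matrix.vecMulVec_mulVec]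
    simp
  have hcX : ∀ w : ι → ℂ, (fun j => c ⬝ᵥ x j - κ * u j) ⬝ᵥ w = c ⬝ᵥ (X *ᵥ w) - κ * (u ⬝ᵥ w) := by
    intro w
    have h1 : (fun j => c ⬝ᵥ x j - κ * u j) = c ᵥ* X - (κ : ℂ) • u := by
      ext j; simp [hX, Matrix.vecMul, dotProduct]
    rw [h1, sub_dotProduct, dotProduct_mulVec, smul_dotProduct, smul_eq_mul]
  have hsum : ∑ j, lurSigma c κ (x j) (u j) =
      ∑ k, lurSigma c κ (X *ᵥ (v k).ofLp) (u ⬝ᵥ (v k).ofLp) := by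
    have := congrArg Complex.re (lur_parseval v u (fun j => c ⬝ᵥ x j - κ * u j))
    simpa only [Complex.re_sum, hcX, lurSigma] using this
  have hstrict : ∀ k, (X *ᵥ (v k).ofLp ≠ 0 ∨ u ⬝ᵥ (v k).ofLp ≠ 0) →
      lurSigma c κ (X *ᵥ (v k).ofLp) (u ⬝ᵥ (v k).ofLp) < 0 := by
    intro k hk
    rcases hv k with h | ⟨ω, h⟩
    · rw [h] at hk ⊢
      have hu : u ⬝ᵥ (v k).ofLp ≠ 0 := by simpa using hk
      set r := u ⬝ᵥ (v k).ofLp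
      have : 0 < Complex.normSq r := Complex.normSq_pos.2 hu
      have e : lurSigma c κ 0 r = - (κ * Complex.normSq r) := by
        simp [lurSigma, Complex.normSq_apply]; ring
      rw [e]
      have := mul_pos hκ this
      linarith
    · rw [hFv] at h
      exact hneg ω _ _ h hk
  have hle : ∀ k, lurSigma c κ (X *ᵥ (v k).ofLp) (u ⬝ᵥ (v k).ofLp) ≤ 0 := by
    intro k
    by_cases hk : (X *ᵥ (v k).ofLp ≠ 0 ∨ u ⬝ᵥ (v k).ofLp ≠ 0)
    · exact (hstrict k hk).le
    · push Not at hk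
      rw [hk.1, hk.2]; simp [lurSigma]
  rw [hsum] at hs
  have hall : ∀ k, X *ᵥ (v k).ofLp = 0 ∧ u ⬝ᵥ (v k).ofLp = 0 := by
    have h1 := (Finset.sum_eq_zero_iff_of_nonpos (fun k _ => hle k)).1
      (le_antisymm (Finset.sum_nonpos fun k _ => hle k) hs)
    intro k
    by_contra hk
    have := hstrict k (by tauto)
    have := h1 k (Finset.mem_univ k)
    linarith
  have hallw : ∀ w : EuclideanSpace ℂ ι, X *ᵥ w.ofLp = 0 ∧ u ⬝ᵥ w.ofLp = 0 := by
    intro w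
    rw [← v.sum_repr w]
    simp only [WithLp.ofLp_sum, WithLp.ofLp_smul, Matrix.mulVec_sum, dotProduct_sum,
      Matrix.mulVec_smul, dotProduct_smul, hall]
    simp
  classical
  have h1 := hallw (WithLp.toLp 2 (Pi.single j 1))
  simp only [Matrix.mulVec_single_one, dotProduct_single_one] at h1
  exact ⟨h1.1, h1.2⟩

theorem lur_kyp_complex {n : ℕ} (M : Matrix (Fin n) (Fin n) ℂ) (b c : Fin n → ℂ) (κ : ℝ)
    (hκ : 0 < κ)
    (hneg : ∀ (ω : ℝ) (x : Fin n → ℂ) (u : ℂ), M *ᵥ x + u • b = (Complex.I * ω) • x →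
      (x ≠ 0 ∨ u ≠ 0) → lurSigma c κ x u < 0) :
    ∃ (l : (Fin n → Fin n → ℂ) →L[ℝ] ℝ) (q : ℝ), 0 < q ∧ ∀ (x : Fin n → ℂ) (u : ℂ),
      (x ≠ 0 ∨ u ≠ 0) → l (lurPhi x (M *ᵥ x + u • b)) + q * lurSigma c κ x u < 0 := by
  classical
  set S : Set ((Fin n → ℂ) × ℂ) := Metric.sphere 0 1 with hS
  have hSc : IsCompact S := isCompact_sphere _ _
  set f : (Fin n → ℂ) × ℂ → (Fin n → Fin n → ℂ) × ℝ := fun p =>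
    (lurPhi p.1 (M *ᵥ p.1 + p.2 • b), lurSigma c κ p.1 p.2) with hf
  have hMc : Continuous fun p : (Fin n → ℂ) × ℂ => M *ᵥ p.1 + p.2 • b := by fun_prop
  have hσc : Continuous fun p : (Fin n → ℂ) × ℂ => lurSigma c κ p.1 p.2 := by
    unfold lurSigma
    have : Continuous fun p : (Fin n → ℂ) × ℂ => c ⬝ᵥ p.1 := by
      unfold dotProduct; fun_prop
    exact Complex.continuous_re.comp (((Complex.continuous_conj.comp continuous_snd)).mul
      (this.sub (continuous_const.mul continuous_snd)))
  have hfc : Continuous f := by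
    refine Continuous.prodMk ?_ hσc
    refine continuous_pi fun i => continuous_pi fun j => ?_
    unfold lurPhi
    have h1 : ∀ i, Continuous fun p : (Fin n → ℂ) × ℂ => (M *ᵥ p.1 + p.2 • b) i :=
      fun i => (continuous_apply i).comp hMc
    have h2 : ∀ i, Continuous fun p : (Fin n → ℂ) × ℂ => p.1 i :=
      fun i => (continuous_apply i).comp continuous_fst
    exact ((h1 i).mul (Complex.continuous_conj.comp (h2 j))).add
      ((h2 i).mul (Complex.continuous_conj.comp (h1 j)))
  have hK := lur_compact_convexHull (hSc.image hfc)
  have hdisj : Disjoint (convexHull ℝ (f '' S)) (({0} : Set (Fin n → Fin n → ℂ)) ×ˢ Ici (0 : ℝ)) := by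
    rw [Set.disjoint_left]
    rintro y hy ⟨hy1, hy2⟩
    obtain ⟨ι, _, w, z, hw0, hw1, hz, rfl⟩ := mem_convexHull_iff_exists_fintype.1 hy
    choose p hp hpz using hz
    have hw : ∀ i, ((Real.sqrt (w i) : ℝ) : ℂ) * (Real.sqrt (w i) : ℝ) = (w i : ℂ) := by
      intro i
      rw [← Complex.ofReal_mul, Real.mul_self_sqrt (hw0 i)]
    have hphi : ∀ i, w i • lurPhi (p i).1 (M *ᵥ (p i).1 + (p i).2 • b) =
        lurPhi (((Real.sqrt (w i) : ℝ) : ℂ) • (p i).1) (M *ᵥ (((Real.sqrt (w i) : ℝ) : ℂ) • (p i).1)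
          + (((Real.sqrt (w i) : ℝ) : ℂ) * (p i).2) • b) := by
      intro i
      rw [Matrix.mulVec_smul, mul_smul, ← smul_add]
      ext k l
      simp only [lurPhi, Pi.smul_apply, Complex.real_smul, smul_eq_mul, map_mul, Complex.conj_ofReal]
      rw [← hw i]; ring
    have hsig : ∀ i, w i * lurSigma c κ (p i).1 (p i).2 =
        lurSigma c κ (((Real.sqrt (w i) : ℝ) : ℂ) • (p i).1)
          (((Real.sqrt (w i) : ℝ) : ℂ) * (p i).2) := by
      intro i
      unfold lurSigma
      rw [← Complex.re_ofReal_mul, ← hw i, dotProduct_smul]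
      simp only [smul_eq_mul, map_mul, Complex.conj_ofReal]
      congr 1; ring
    have key := lur_disjoint M b c κ hκ hneg (fun i => ((Real.sqrt (w i) : ℝ) : ℂ) • (p i).1)
      (fun i => ((Real.sqrt (w i) : ℝ) : ℂ) * (p i).2)
      (by
        simp only [← hphi]
        have : (∑ i, w i • z i).1 = 0 := hy1
        rw [Prod.fst_sum] at this
        simpa [← hpz, hf] using this)
      (by
        simp only [← hsig]
        have : 0 ≤ (∑ i, w i • z i).2 := hy2
        rw [Prod.snd_sum] at this
        simpa [← hpz, hf] using this)
    have hw00 : ∀ i, w i = 0 := by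
      intro i
      by_contra hne
      have hpos : 0 < w i := lt_of_le_of_ne (hw0 i) (Ne.symm hne)
      have hsq : ((Real.sqrt (w i) : ℝ) : ℂ) ≠ 0 := by
        exact_mod_cast (Real.sqrt_pos.2 hpos).ne'
      have h1 : (p i).1 = 0 := (smul_eq_zero.1 (key i).1).resolve_left hsq
      have h2 : (p i).2 = 0 := (mul_eq_zero.1 (key i).2).resolve_left hsq
      have h3 : p i = 0 := Prod.ext h1 h2
      have := hp i
      rw [h3, hS] at this
      simp at this
    simp [hw00] at hw1
  obtain ⟨g, a, a', hga, haa, hgb⟩ := geometric_hahn_banach_compact_closed (convex_convexHull ℝ _) hK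
    ((convex_singleton _).prod (convex_Ici 0)) (isClosed_singleton.prod isClosed_Ici) hdisj
  have ha'0 : a' < 0 := by
    have := hgb (0, 0) (by simp)
    rw [show ((0 : Fin n → Fin n → ℂ), (0 : ℝ)) = 0 from rfl, map_zero] at this
    exact this
  have hgsplit : ∀ (P : Fin n → Fin n → ℂ) (s : ℝ), g (P, s) = g (P, 0) + s * g (0, 1) := by
    intro P s
    have : ((P, s) : (Fin n → Fin n → ℂ) × ℝ) = (P, 0) + s • ((0, 1) : (Fin n → Fin n → ℂ) × ℝ) := by
      simp
    rw [this, map_add, map_smul, smul_eq_mul]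
  have hq0 : 0 ≤ g (0, 1) := by
    by_contra hlt
    push Not at hlt
    have h1 := hgb (0, a' / g (0, 1)) (by
      refine ⟨rfl, ?_⟩
      exact (div_pos_of_neg_of_neg ha'0 hlt).le)
    rw [hgsplit, div_mul_cancel₀ _ hlt.ne] at h1
    rw [show ((0 : Fin n → Fin n → ℂ), (0 : ℝ)) = 0 from rfl, map_zero] at h1
    linarith
  obtain ⟨R, hR⟩ := hSc.exists_bound_of_continuousOn hσc.continuousOn
  set η : ℝ := -a' / (|R| + 1) with hη
  have hηpos : 0 < η := div_pos (by linarith) (by positivity)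
  refine ⟨g.comp (ContinuousLinearMap.inl ℝ _ _), g (0, 1) + η, by linarith, ?_⟩
  have hSneg : ∀ p ∈ S, g.comp (ContinuousLinearMap.inl ℝ _ _) (lurPhi p.1 (M *ᵥ p.1 + p.2 • b))
      + (g (0, 1) + η) * lurSigma c κ p.1 p.2 < 0 := by
    intro p hp
    have h1 := hga (f p) (subset_convexHull ℝ _ ⟨p, hp, rfl⟩)
    rw [hf] at h1
    simp only at h1
    rw [hgsplit] at h1
    have h2 := hR p hp
    rw [Real.norm_eq_abs] at h2
    have h3 : η * lurSigma c κ p.1 p.2 ≤ -a' := by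
      have : lurSigma c κ p.1 p.2 ≤ |R| + 1 := by
        have := le_abs_self (lurSigma c κ p.1 p.2)
        have := le_abs_self R
        linarith
      calc η * lurSigma c κ p.1 p.2 ≤ η * (|R| + 1) := by gcongr
        _ = -a' := by rw [hη]; field_simp
    simp only [ContinuousLinearMap.comp_apply, ContinuousLinearMap.inl_apply]
    linarith
  intro x u hxu
  set p : (Fin n → ℂ) × ℂ := (x, u) with hp
  have hpne : p ≠ 0 := by
    intro h
    have h1 : x = 0 := congrArg Prod.fst h
    have h2 : u = 0 := congrArg Prod.snd h
    tauto
  have hr : 0 < ‖p‖ := norm_pos_iff.2 hpne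
  have h1 := hSneg ((‖p‖⁻¹ : ℝ) • p) (by
    rw [hS, mem_sphere_zero_iff_norm, norm_smul, norm_inv, norm_norm, inv_mul_cancel₀ hr.ne'])
  set r := ‖p‖⁻¹ with hrdef
  have hrpos : 0 < r := inv_pos.2 hr
  have e1 : lurPhi (r • p).1 (M *ᵥ (r • p).1 + (r • p).2 • b) =
      (r ^ 2) • lurPhi x (M *ᵥ x + u • b) := by
    have h5 : (r • p).1 = (r : ℂ) • x := by ext i; simp [hp]
    have h6 : (r • p).2 = (r : ℂ) * u := by simp [hp]
    rw [h5, h6, Matrix.mulVec_smul, mul_smul, ← smul_add]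
    ext k l
    simp only [lurPhi, Pi.smul_apply, Complex.real_smul, smul_eq_mul, map_mul, Complex.conj_ofReal]
    push_cast; ring
  have e2 : lurSigma c κ (r • p).1 (r • p).2 = r ^ 2 * lurSigma c κ x u := by
    have h5 : (r • p).1 = (r : ℂ) • x := by ext i; simp [hp]
    have h6 : (r • p).2 = (r : ℂ) * u := by simp [hp]
    rw [h5, h6]
    unfold lurSigma
    rw [← Complex.re_ofReal_mul, dotProduct_smul]
    simp only [smul_eq_mul, map_mul, Complex.conj_ofReal]
    congr 1; push_cast; ring
  rw [e1, e2, map_smul, smul_eq_mul] at h1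
  have h7 : r ^ 2 * ((g.comp (ContinuousLinearMap.inl ℝ _ _)) (lurPhi x (M *ᵥ x + u • b))
      + (g (0, 1) + η) * lurSigma c κ x u) < 0 := by linarith
  by_contra hcon
  push Not at hcon
  have := mul_nonneg (sq_nonneg r) hcon
  linarith

theorem lur_mem_spectrum_iff {n : ℕ} (M : Matrix (Fin n) (Fin n) ℂ) (μ : ℂ) :
    μ ∈ spectrum ℂ M ↔ ∃ v : Fin n → ℂ, v ≠ 0 ∧ M *ᵥ v = μ • v := by
  rw [← Matrix.spectrum_toLin', ← Module.End.hasEigenvalue_iff_mem_spectrum]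
  constructor
  · intro h
    obtain ⟨v, hv, hv0⟩ := h.exists_hasEigenvector
    rw [Module.End.mem_eigenspace_iff, Matrix.toLin'_apply] at hv
    exact ⟨v, hv0, hv⟩
  · rintro ⟨v, hv0, hv⟩
    refine Module.End.hasEigenvalue_of_hasEigenvector (x := v) ⟨?_, hv0⟩
    rw [Module.End.mem_eigenspace_iff, Matrix.toLin'_apply, hv]

section
attribute [local instance] Matrix.linftyOpNormedRing Matrix.linftyOpNormedAlgebra

theorem lur_pow_tendsto {n : ℕ} (hn : 0 < n) (T : Matrix (Fin n) (Fin n) ℂ)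
    (hT : ∀ μ ∈ spectrum ℂ T, ‖μ‖ < 1) :
    Filter.Tendsto (fun k : ℕ => T ^ k) Filter.atTop (nhds 0) := by
  have : Nonempty (Fin n) := ⟨⟨0, hn⟩⟩
  have : CompleteSpace (Matrix (Fin n) (Fin n) ℂ) := FiniteDimensional.complete ℂ _
  have h1 : spectralRadius ℂ T < (1 : NNReal) :=
    spectrum.spectralRadius_lt_of_forall_lt T (fun z hz => by
      have := hT z hz
      exact_mod_cast this)
  obtain ⟨r, hr1, hr2⟩ := ENNReal.lt_iff_exists_nnreal_btwn.1 h1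
  have hr2' : r < 1 := by exact_mod_cast hr2
  have h2 := (spectrum.pow_nnnorm_pow_one_div_tendsto_nhds_spectralRadius T).eventually_lt_const hr1
  have hz : Filter.Tendsto (fun k : ℕ => (r : ℝ) ^ k) Filter.atTop (nhds 0) :=
    tendsto_pow_atTop_nhds_zero_of_lt_one r.2 (by exact_mod_cast hr2')
  refine squeeze_zero_norm' ?_ hz
  filter_upwards [h2, Filter.eventually_gt_atTop 0] with k hk hk0
  have hk0' : (0 : ℝ) < k := by exact_mod_cast hk0
  have h3 : (‖T ^ k‖₊ : ENNReal) ≤ (r : ENNReal) ^ (k : ℝ) := by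
    have := ENNReal.rpow_le_rpow hk.le hk0'.le
    rwa [← ENNReal.rpow_mul, one_div, inv_mul_cancel₀ hk0'.ne', ENNReal.rpow_one] at this
  rw [ENNReal.rpow_natCast] at h3
  have h4 : ‖T ^ k‖₊ ≤ r ^ k := by exact_mod_cast h3
  exact_mod_cast h4

end

theorem lur_phi_continuous {n : ℕ} : Continuous fun x : Fin n → ℂ => lurPhi x x := by
  refine continuous_pi fun i => continuous_pi fun j => ?_
  unfold lurPhi
  have h2 : ∀ i, Continuous fun p : Fin n → ℂ => p i := fun i => continuous_apply i
  exact ((h2 i).mul (Complex.continuous_conj.comp (h2 j))).add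
      ((h2 i).mul (Complex.continuous_conj.comp (h2 j)))

theorem lur_lyap_pos {n : ℕ} (M : Matrix (Fin n) (Fin n) ℂ)
    (hM : ∀ μ ∈ spectrum ℂ M, μ.re < 0) (l : (Fin n → Fin n → ℂ) →L[ℝ] ℝ)
    (hl : ∀ x : Fin n → ℂ, x ≠ 0 → l (lurPhi x (M *ᵥ x)) < 0) (x : Fin n → ℂ) (hx : x ≠ 0) :
    0 < l (lurPhi x x) := by
  have hn : 0 < n := by
    rcases Nat.eq_zero_or_pos n with rfl | h
    · exact absurd (Subsingleton.elim _ _) hx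
    · exact h
  have hu : IsUnit (1 - M) := by
    have : (1 : ℂ) ∉ spectrum ℂ M := fun h => by
      have := hM 1 h; simp at this; linarith
    rw [spectrum.mem_iff, not_not] at this
    simpa using this
  have hdet : IsUnit (1 - M).det := (Matrix.isUnit_iff_isUnit_det _).1 hu
  set T := (1 + M) * (1 - M)⁻¹ with hT
  have hTy : ∀ y, T *ᵥ (y - M *ᵥ y) = y + M *ᵥ y := by
    intro y
    have e : y - M *ᵥ y = (1 - M) *ᵥ y := by rw [Matrix.sub_mulVec, Matrix.one_mulVec]
    rw [e, hT, Matrix.mulVec_mulVec, Matrix.mul_assoc, Matrix.nonsing_inv_mul _ hdet, Matrix.mul_one,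
      Matrix.add_mulVec, Matrix.one_mulVec]
  have hsurj : ∀ x, ∃ y, x = y - M *ᵥ y := by
    intro x
    refine ⟨(1 - M)⁻¹ *ᵥ x, ?_⟩
    have e : ∀ y, y - M *ᵥ y = (1 - M) *ᵥ y := by
      intro y; rw [Matrix.sub_mulVec, Matrix.one_mulVec]
    rw [e, Matrix.mulVec_mulVec, Matrix.mul_nonsing_inv _ hdet, Matrix.one_mulVec]
  have hTs : ∀ μ ∈ spectrum ℂ T, ‖μ‖ < 1 := by
    intro μ hμ
    obtain ⟨v, hv0, hv⟩ := (lur_mem_spectrum_iff T μ).1 hμ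
    obtain ⟨y, rfl⟩ := hsurj v
    rw [hTy] at hv
    have hy0 : y ≠ 0 := by rintro rfl; simp at hv0
    have h1 : (μ + 1) • (M *ᵥ y) = (μ - 1) • y := by
      funext i
      have := congrFun hv i
      simp at this ⊢
      linear_combination this
    have hne : μ + 1 ≠ 0 := by
      intro h
      rw [h, zero_smul] at h1
      have h2 : μ - 1 = 0 := (smul_eq_zero.1 h1.symm).resolve_right hy0
      have h3 : (2 : ℂ) = 0 := by linear_combination h - h2
      norm_num at h3
    have h2 : M *ᵥ y = ((μ - 1) / (μ + 1)) • y := by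
      rw [div_eq_inv_mul, mul_smul, ← h1, smul_smul, inv_mul_cancel₀ hne, one_smul]
    have h3 := hM _ ((lur_mem_spectrum_iff M _).2 ⟨y, hy0, h2⟩)
    rw [Complex.div_re, ← add_div] at h3
    have h4 : 0 < Complex.normSq (μ + 1) := Complex.normSq_pos.2 hne
    have h5 := (div_neg_iff.1 h3).resolve_left (by rintro ⟨_, h⟩; linarith)
    have h6 := h5.1
    simp at h6
    have h7 : ‖μ‖ ^ 2 < 1 := by
      rw [Complex.sq_norm, Complex.normSq_apply]; nlinarith
    nlinarith [norm_nonneg μ]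
  have hdec : ∀ x, x ≠ 0 → l (lurPhi (T *ᵥ x) (T *ᵥ x)) < l (lurPhi x x) := by
    intro x hx
    obtain ⟨y, rfl⟩ := hsurj x
    have hy0 : y ≠ 0 := by rintro rfl; simp at hx
    rw [hTy]
    have e : lurPhi (y + M *ᵥ y) (y + M *ᵥ y) =
        lurPhi (y - M *ᵥ y) (y - M *ᵥ y) + (4 : ℝ) • lurPhi y (M *ᵥ y) := by
      ext i j
      simp [lurPhi]
      ring
    rw [e, map_add, map_smul, smul_eq_mul]
    have := hl y hy0
    linarith
  have hdec' : ∀ x, l (lurPhi (T *ᵥ x) (T *ᵥ x)) ≤ l (lurPhi x x) := by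
    intro x
    by_cases h : x = 0
    · simp [h]
    · exact (hdec x h).le
  have hpow := lur_pow_tendsto hn T hTs
  have hlim : Filter.Tendsto (fun k : ℕ => l (lurPhi ((T ^ k) *ᵥ x) ((T ^ k) *ᵥ x)))
      Filter.atTop (nhds 0) := by
    have hc : Continuous fun S : Matrix (Fin n) (Fin n) ℂ => l (lurPhi (S *ᵥ x) (S *ᵥ x)) :=
      l.continuous.comp (lur_phi_continuous.comp (continuous_id.matrix_mulVec continuous_const))
    have := (hc.tendsto 0).comp hpow
    have e : lurPhi ((0 : Matrix (Fin n) (Fin n) ℂ) *ᵥ x) (0 *ᵥ x) = 0 := by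
      ext i j; simp [lurPhi]
    rw [e, map_zero] at this
    exact this
  have hmono : Antitone (fun k : ℕ => l (lurPhi ((T ^ k) *ᵥ x) ((T ^ k) *ᵥ x))) := by
    refine antitone_nat_of_succ_le fun k => ?_
    have := hdec' ((T ^ k) *ᵥ x)
    rwa [Matrix.mulVec_mulVec, ← pow_succ'] at this
  have h1 := hmono.le_of_tendsto hlim 1
  have h2 := hdec x hx
  simp only [pow_one] at h1
  linarith

theorem lur_homog {E : Type*} [NormedAddCommGroup E] [NormedSpace ℝ E] [FiniteDimensional ℝ E]
    (f : E → ℝ) (hf : Continuous f) (hh : ∀ (r : ℝ) x, f (r • x) = r ^ 2 * f x)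
    (hpos : ∀ x, x ≠ 0 → 0 < f x) :
    ∃ m R : ℝ, 0 < m ∧ 0 < R ∧ ∀ x, m * ‖x‖ ^ 2 ≤ f x ∧ f x ≤ R * ‖x‖ ^ 2 := by
  have hc : IsCompact (Metric.sphere (0 : E) 1) := isCompact_sphere _ _
  have h0 : f 0 = 0 := by have := hh 0 0; simpa using this
  obtain ⟨m, R, hm, hR, hb⟩ : ∃ m R : ℝ, 0 < m ∧ 0 < R ∧ ∀ x ∈ Metric.sphere (0 : E) 1,
      m ≤ f x ∧ f x ≤ R := by
    rcases (Metric.sphere (0 : E) 1).eq_empty_or_nonempty with he | hne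
    · exact ⟨1, 1, one_pos, one_pos, by simp [he]⟩
    · obtain ⟨a, ha, hamin⟩ := hc.exists_isMinOn hne hf.continuousOn
      obtain ⟨b, hb, hbmax⟩ := hc.exists_isMaxOn hne hf.continuousOn
      have hne0 : ∀ a ∈ Metric.sphere (0 : E) 1, a ≠ 0 := by
        rintro a ha rfl; simp at ha
      exact ⟨f a, f b, hpos a (hne0 a ha), hpos b (hne0 b hb), fun x hx => ⟨hamin hx, hbmax hx⟩⟩
  refine ⟨m, R, hm, hR, fun x => ?_⟩
  by_cases hx : x = 0
  · simp [hx, h0]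
  have hn : 0 < ‖x‖ := norm_pos_iff.2 hx
  have h1 := hb (‖x‖⁻¹ • x) (by
    rw [mem_sphere_zero_iff_norm, norm_smul, norm_inv, norm_norm, inv_mul_cancel₀ hn.ne'])
  have h2 : f x = ‖x‖ ^ 2 * f (‖x‖⁻¹ • x) := by
    rw [← hh, smul_smul, mul_inv_cancel₀ hn.ne', one_smul]
  rw [h2]
  have := sq_nonneg ‖x‖
  constructor <;> nlinarith

theorem lur_hneg {n : ℕ} (M : Matrix (Fin n) (Fin n) ℂ) (b c : Fin n → ℂ) (κ : ℝ)
    (hM : ∀ μ ∈ spectrum ℂ M, μ.re < 0)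
    (hfreq : ∀ ω : ℝ,
      (c ⬝ᵥ (((Complex.I * (ω : ℂ)) • (1 : Matrix (Fin n) (Fin n) ℂ) - M)⁻¹ *ᵥ b)).re < κ)
    (ω : ℝ) (x : Fin n → ℂ) (u : ℂ) (h : M *ᵥ x + u • b = (Complex.I * ω) • x)
    (hxu : x ≠ 0 ∨ u ≠ 0) : lurSigma c κ x u < 0 := by
  set N := (Complex.I * (ω : ℂ)) • (1 : Matrix (Fin n) (Fin n) ℂ) - M with hN
  have hu : IsUnit N := by
    have : (Complex.I * (ω : ℂ)) ∉ spectrum ℂ M := fun h => by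
      have := hM _ h; simp at this
    rw [spectrum.mem_iff, not_not, Algebra.algebraMap_eq_smul_one] at this
    exact this
  have hdet : IsUnit N.det := (Matrix.isUnit_iff_isUnit_det _).1 hu
  have h1 : N *ᵥ x = u • b := by
    rw [hN, Matrix.sub_mulVec, Matrix.smul_mulVec, Matrix.one_mulVec, ← h]
    abel
  have h2 : x = u • (N⁻¹ *ᵥ b) := by
    rw [← Matrix.mulVec_smul, ← h1, Matrix.mulVec_mulVec, Matrix.nonsing_inv_mul _ hdet,
      Matrix.one_mulVec]
  have hu0 : u ≠ 0 := by
    rcases hxu with hx | hu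
    · rintro rfl; apply hx; rw [h2, zero_smul]
    · exact hu
  have h3 := hfreq ω
  rw [← hN] at h3
  have e : lurSigma c κ x u = Complex.normSq u * ((c ⬝ᵥ (N⁻¹ *ᵥ b)).re - κ) := by
    unfold lurSigma
    rw [h2, dotProduct_smul, smul_eq_mul]
    set G := c ⬝ᵥ (N⁻¹ *ᵥ b)
    have : (starRingEnd ℂ) u * (u * G - κ * u) = (Complex.normSq u : ℂ) * (G - κ) := by
      rw [← Complex.mul_conj]; ring
    rw [this, Complex.re_ofReal_mul]; simp
  rw [e]
  exact mul_neg_of_pos_of_neg (Complex.normSq_pos.2 hu0) (by linarith)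

/-- Embedding of real vectors into complex vectors. -/
def lurJ {n : ℕ} (x : Fin n → ℝ) : Fin n → ℂ := fun i => (x i : ℂ)

theorem lur_real_kyp {n : ℕ} (A : Matrix (Fin n) (Fin n) ℝ) (B C : Fin n → ℝ) (k_f : ℝ)
    (hk_f : 0 < k_f)
    (hHurwitz : ∀ μ ∈ spectrum ℂ (A.map (fun a : ℝ => (a : ℂ))), μ.re < 0)
    (hfreq : ∀ ω : ℝ,
      ((fun i => (C i : ℂ)) ⬝ᵥ
        (((Complex.I * (ω : ℂ)) • (1 : Matrix (Fin n) (Fin n) ℂ)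
            - A.map (fun a : ℝ => (a : ℂ)))⁻¹ *ᵥ fun i => (B i : ℂ))).re < 1 / k_f) :
    ∃ (l : (Fin n → Fin n → ℂ) →L[ℝ] ℝ) (q δ m R : ℝ), 0 < q ∧ 0 < δ ∧ 0 < m ∧ 0 < R ∧
      (∀ x : EuclideanSpace ℝ (Fin n), m * ‖x‖ ^ 2 ≤ l (lurPhi (lurJ x.ofLp) (lurJ x.ofLp)) ∧
        l (lurPhi (lurJ x.ofLp) (lurJ x.ofLp)) ≤ R * ‖x‖ ^ 2) ∧
      ∀ (x : EuclideanSpace ℝ (Fin n)) (u : ℝ),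
        l (lurPhi (lurJ x.ofLp) (lurJ (A *ᵥ x.ofLp + u • B))) +
          q * (u * (C ⬝ᵥ x.ofLp - (1 / k_f) * u)) ≤ - δ * ‖x‖ ^ 2 := by
  have hκ : 0 < 1 / k_f := by positivity
  obtain ⟨l, q, hq, hl⟩ := lur_kyp_complex _ _ _ (1 / k_f) hκ
    (lur_hneg _ _ _ (1 / k_f) hHurwitz hfreq)
  have hpos := lur_lyap_pos _ hHurwitz l (fun x hx => by
    have := hl x 0 (Or.inl hx)
    simpa [lurSigma] using this)
  have hJ0 : ∀ x : EuclideanSpace ℝ (Fin n), lurJ x.ofLp = 0 → x = 0 := by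
    intro x h
    ext i
    have := congrFun h i
    simpa [lurJ] using this
  have hJc : Continuous fun x : EuclideanSpace ℝ (Fin n) => lurJ x.ofLp := by
    unfold lurJ
    fun_prop
  have hJs : ∀ (r : ℝ) (x : Fin n → ℝ), lurJ (r • x) = (r : ℂ) • lurJ x := by
    intro r x; ext i; simp [lurJ]
  have hphis : ∀ (r : ℝ) (x f : Fin n → ℂ), lurPhi ((r : ℂ) • x) ((r : ℂ) • f) =
      (r ^ 2) • lurPhi x f := by
    intro r x f
    ext i j
    simp [lurPhi]; ring
  obtain ⟨m, R, hm, hR, hb⟩ := lur_homog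
    (fun x : EuclideanSpace ℝ (Fin n) => l (lurPhi (lurJ x.ofLp) (lurJ x.ofLp)))
    (l.continuous.comp (lur_phi_continuous.comp hJc))
    (by
      intro r x
      rw [WithLp.ofLp_smul, hJs, hphis, map_smul, smul_eq_mul])
    (fun x hx => hpos _ (fun h => hx (hJ0 x h)))
  have hJA : ∀ (x : Fin n → ℝ) (u : ℝ), A.map (fun a : ℝ => (a : ℂ)) *ᵥ lurJ x +
      (u : ℂ) • (fun i => (B i : ℂ)) = lurJ (A *ᵥ x + u • B) := by
    intro x u
    ext i
    simp [lurJ, Matrix.mulVec, dotProduct]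
  have hsig : ∀ (x : Fin n → ℝ) (u : ℝ), lurSigma (fun i => (C i : ℂ)) (1 / k_f) (lurJ x) (u : ℂ) =
      u * (C ⬝ᵥ x - (1 / k_f) * u) := by
    intro x u
    have e : (fun i => (C i : ℂ)) ⬝ᵥ lurJ x = ((C ⬝ᵥ x : ℝ) : ℂ) := by
      simp [lurJ, dotProduct]
    unfold lurSigma
    rw [e, Complex.conj_ofReal, Complex.re_ofReal_mul]
    simp only [← Complex.ofReal_mul, ← Complex.ofReal_sub, Complex.ofReal_re]
  obtain ⟨δ, _, hδ, _, hd⟩ := lur_homog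
    (fun p : EuclideanSpace ℝ (Fin n) × ℝ =>
      -(l (lurPhi (lurJ p.1.ofLp) (lurJ (A *ᵥ p.1.ofLp + p.2 • B))) +
          q * (p.2 * (C ⬝ᵥ p.1.ofLp - (1 / k_f) * p.2))))
    (by
      have h1 : Continuous fun p : EuclideanSpace ℝ (Fin n) × ℝ => C ⬝ᵥ p.1.ofLp := by
        unfold dotProduct; fun_prop
      have h2 : Continuous fun p : EuclideanSpace ℝ (Fin n) × ℝ => A *ᵥ p.1.ofLp + p.2 • B := by
        unfold Matrix.mulVec dotProduct; fun_prop
      have h3 : Continuous fun p : EuclideanSpace ℝ (Fin n) × ℝ =>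
          lurPhi (lurJ p.1.ofLp) (lurJ (A *ᵥ p.1.ofLp + p.2 • B)) := by
        have h4 : ∀ i, Continuous fun p : EuclideanSpace ℝ (Fin n) × ℝ =>
            lurJ (A *ᵥ p.1.ofLp + p.2 • B) i := fun i =>
          Complex.continuous_ofReal.comp ((continuous_apply i).comp h2)
        have h5 : ∀ i, Continuous fun p : EuclideanSpace ℝ (Fin n) × ℝ => lurJ p.1.ofLp i := fun i =>
          (continuous_apply i).comp (hJc.comp continuous_fst)
        refine continuous_pi fun i => continuous_pi fun j => ?_
        exact ((h4 i).mul (Complex.continuous_conj.comp (h5 j))).add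
          ((h5 i).mul (Complex.continuous_conj.comp (h4 j)))
      exact ((l.continuous.comp h3).add (continuous_const.mul (continuous_snd.mul
        (h1.sub (continuous_const.mul continuous_snd))))).neg)
    (by
      rintro r ⟨x, u⟩
      simp only [Prod.smul_mk, WithLp.ofLp_smul, smul_eq_mul]
      have e : A *ᵥ (r • x.ofLp) + (r * u) • B = r • (A *ᵥ x.ofLp + u • B) := by
        rw [Matrix.mulVec_smul, mul_smul, smul_add]
      rw [e, hJs, hJs, hphis, map_smul, smul_eq_mul, dotProduct_smul, smul_eq_mul]
      ring)
    (by
      rintro ⟨x, u⟩ hxu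
      have h1 := hl (lurJ x.ofLp) (u : ℂ) (by
        by_contra hcon
        push Not at hcon
        apply hxu
        have h2 := hJ0 x hcon.1
        have h3 : u = 0 := by exact_mod_cast hcon.2
        rw [h2, h3]; rfl)
      rw [hJA, hsig] at h1
      simp only
      linarith)
  refine ⟨l, q, δ, m, R, hq, hδ, hm, hR, hb, fun x u => ?_⟩
  have h1 := (hd (x, u)).1
  simp only at h1
  have h2 : ‖x‖ ≤ ‖(x, u)‖ := norm_fst_le (x, u)
  have h3 : ‖x‖ ^ 2 ≤ ‖(x, u)‖ ^ 2 := by gcongr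
  have h4 := mul_le_mul_of_nonneg_left h3 hδ.le
  linarith

/-- Under the Hurwitz and frequency-domain assumptions of the
circle criterion, there are `C₁ ≥ 1` and `ε > 0` (depending only on `A, B, C, k_f`)
such that for every slope-restricted nonlinearity `h` with `h(0) = 0`:
(a) every solution of the undisturbed Lur'e system `ẋ = A x + B h(C x)` on `[0,∞)`
satisfies `‖x(t)‖ ≤ C₁ e^{−εt} ‖x(0)‖`, and (b) the origin is the unique
equilibrium. -/
theorem lurie_undisturbed_exponential_stability_unique_equilibrium
    (n : ℕ) (A : Matrix (Fin n) (Fin n) ℝ) (B C : Fin n → ℝ) (k_f : ℝ)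
    (hk_f : 0 < k_f)
    (hHurwitz : ∀ μ ∈ spectrum ℂ (A.map (fun a : ℝ => (a : ℂ))), μ.re < 0)
    (hfreq : ∀ ω : ℝ,
      ((fun i => (C i : ℂ)) ⬝ᵥ
        (((Complex.I * (ω : ℂ)) • (1 : Matrix (Fin n) (Fin n) ℂ)
            - A.map (fun a : ℝ => (a : ℂ)))⁻¹ *ᵥ fun i => (B i : ℂ))).re < 1 / k_f) :
    ∃ (C₁ ε : ℝ), 1 ≤ C₁ ∧ 0 < ε ∧
      ∀ h : ℝ → ℝ,
        (∀ y₁ y₂ : ℝ, 0 ≤ (h y₁ - h y₂) * (y₁ - y₂) ∧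
            (h y₁ - h y₂) * (y₁ - y₂) ≤ k_f * (y₁ - y₂) ^ 2) →
        h 0 = 0 →
        (∀ x : ℝ → EuclideanSpace ℝ (Fin n),
          (∀ t ∈ Ici (0 : ℝ),
            HasDerivWithinAt x
              ((EuclideanSpace.equiv (Fin n) ℝ).symm
                (A *ᵥ (fun i => x t i) + h (C ⬝ᵥ fun i => x t i) • B)) (Ici 0) t) →
          ∀ t ∈ Ici (0 : ℝ), ‖x t‖ ≤ C₁ * Real.exp (-ε * t) * ‖x 0‖) ∧
        (∀ xs : Fin n → ℝ, A *ᵥ xs + h (C ⬝ᵥ xs) • B = 0 ↔ xs = 0) := by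

  obtain ⟨l, q, δ, m, R, hq, hδ, hm, hR, hb, hd⟩ :=
    lur_real_kyp A B C k_f hk_f hHurwitz hfreq
  refine ⟨1 + Real.sqrt (R / m), δ / R, by linarith [Real.sqrt_nonneg (R / m)], by positivity, ?_⟩
  intro h hslope h0
  have hsec : ∀ y, 0 ≤ h y * (y - (1 / k_f) * h y) := by
    intro y
    obtain ⟨h1, h2⟩ := hslope y 0
    rw [h0, sub_zero, sub_zero] at h1 h2
    have h3 : 0 ≤ h y * (k_f * y - h y) := by
      rcases lt_trichotomy y 0 with hy | hy | hy
      · have h4 : h y ≤ 0 := by nlinarith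
        have h5 : k_f * y ≤ h y := by
          by_contra hcon; push Not at hcon
          nlinarith
        nlinarith
      · subst hy; rw [h0]; simp
      · have h4 : 0 ≤ h y := by nlinarith
        have h5 : h y ≤ k_f * y := by
          by_contra hcon; push Not at hcon
          nlinarith
        nlinarith
    have e : h y * (y - (1 / k_f) * h y) = (1 / k_f) * (h y * (k_f * y - h y)) := by
      field_simp
    rw [e]; positivity
  have hdiss : ∀ x : EuclideanSpace ℝ (Fin n),
      l (lurPhi (lurJ x.ofLp) (lurJ (A *ᵥ x.ofLp + h (C ⬝ᵥ x.ofLp) • B))) ≤ - δ * ‖x‖ ^ 2 := by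
    intro x
    have h1 := hd x (h (C ⬝ᵥ x.ofLp))
    have h2 := mul_nonneg hq.le (hsec (C ⬝ᵥ x.ofLp))
    linarith
  refine ⟨?_, ?_⟩
  · intro x hx t ht
    set ε := δ / R with hε
    have hεR : ε * R = δ := by rw [hε]; field_simp
    have hε0 : 0 < ε := by positivity
    set V : ℝ → ℝ := fun t => l (lurPhi (lurJ (x t).ofLp) (lurJ (x t).ofLp)) with hV
    set D : ℝ → ℝ := fun t => l (lurPhi (lurJ (x t).ofLp)
      (lurJ (A *ᵥ (x t).ofLp + h (C ⬝ᵥ (x t).ofLp) • B))) with hD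
    have hVd : ∀ t ∈ Ici (0 : ℝ), HasDerivWithinAt V (2 * D t) (Ici 0) t := by
      intro t ht
      have h1 := hx t ht
      set F : Fin n → ℝ := A *ᵥ (x t).ofLp + h (C ⬝ᵥ (x t).ofLp) • B with hF
      have h2 : ∀ i, HasDerivWithinAt (fun s => lurJ (x s).ofLp i) (lurJ F i) (Ici 0) t := by
        intro i
        have h3 := ((EuclideanSpace.proj (𝕜 := ℝ) i).hasFDerivAt
          (x := x t)).comp_hasDerivWithinAt t h1
        exact h3.ofReal_comp
      have h4 : HasDerivWithinAt (fun s => lurPhi (lurJ (x s).ofLp) (lurJ (x s).ofLp))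
          ((2 : ℝ) • lurPhi (lurJ (x t).ofLp) (lurJ F)) (Ici 0) t := by
        refine hasDerivWithinAt_pi.2 fun i => hasDerivWithinAt_pi.2 fun j => ?_
        have h5 := ((h2 i).mul (h2 j)).add ((h2 i).mul (h2 j))
        have hc : ∀ (y : Fin n → ℝ) k, (starRingEnd ℂ) (lurJ y k) = lurJ y k := by
          intro y k; simp [lurJ]
        simp only [lurPhi, hc, Pi.smul_apply, Complex.real_smul]
        convert! h5 using 1
        push_cast; ring
      have h6 := l.hasFDerivAt.comp_hasDerivWithinAt t h4
      rw [map_smul, smul_eq_mul] at h6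
      exact h6
    have hW : AntitoneOn (fun t => Real.exp (2 * ε * t) * V t) (Ici 0) := by
      have hWd : ∀ t ∈ Ici (0 : ℝ), HasDerivWithinAt (fun t => Real.exp (2 * ε * t) * V t)
          (Real.exp (2 * ε * t) * (2 * ε) * V t + Real.exp (2 * ε * t) * (2 * D t)) (Ici 0) t := by
        intro t ht
        have h1 : HasDerivAt (fun t => Real.exp (2 * ε * t)) (Real.exp (2 * ε * t) * (2 * ε)) t := by
          have := ((hasDerivAt_id t).const_mul (2 * ε)).exp
          simpa using this
        exact h1.hasDerivWithinAt.mul (hVd t ht)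
      refine antitoneOn_of_hasDerivWithinAt_nonpos (convex_Ici 0)
        (fun t ht => (hWd t ht).continuousWithinAt)
        (fun t ht => (hWd t (interior_subset ht)).mono interior_subset) ?_
      intro t ht
      have h1 : V t ≤ R * ‖x t‖ ^ 2 := (hb (x t)).2
      have h2 : D t ≤ - δ * ‖x t‖ ^ 2 := hdiss (x t)
      have h3 : ε * V t ≤ δ * ‖x t‖ ^ 2 := by
        calc ε * V t ≤ ε * (R * ‖x t‖ ^ 2) := by gcongr
          _ = δ * ‖x t‖ ^ 2 := by rw [← mul_assoc, hεR]
      have h4 : Real.exp (2 * ε * t) * (2 * ε) * V t + Real.exp (2 * ε * t) * (2 * D t) =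
          Real.exp (2 * ε * t) * (2 * (ε * V t + D t)) := by ring
      rw [h4]
      exact mul_nonpos_of_nonneg_of_nonpos (Real.exp_pos _).le (by linarith)
    have h1 := hW (Set.mem_Ici.2 le_rfl) ht ht
    simp only [mul_zero, Real.exp_zero, one_mul] at h1
    have h2 : m * ‖x t‖ ^ 2 ≤ V t := (hb (x t)).1
    have h3 : V 0 ≤ R * ‖x 0‖ ^ 2 := (hb (x 0)).2
    have h4 : Real.exp (2 * ε * t) * (m * ‖x t‖ ^ 2) ≤ R * ‖x 0‖ ^ 2 :=
      (mul_le_mul_of_nonneg_left h2 (Real.exp_pos _).le).trans (h1.trans h3)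
    set s := Real.sqrt (R / m) with hs
    have hs0 : 0 ≤ s := Real.sqrt_nonneg _
    have hss : m * s ^ 2 = R := by
      rw [hs, Real.sq_sqrt (by positivity)]; field_simp
    have hee : Real.exp (2 * ε * t) = Real.exp (ε * t) ^ 2 := by
      rw [← Real.exp_nat_mul]; congr 1; push_cast; ring
    have h5 : (Real.exp (ε * t) * ‖x t‖) ^ 2 ≤ (s * ‖x 0‖) ^ 2 := by
      rw [hee, ← hss] at h4
      refine le_of_mul_le_mul_left ?_ hm
      calc m * (Real.exp (ε * t) * ‖x t‖) ^ 2 = Real.exp (ε * t) ^ 2 * (m * ‖x t‖ ^ 2) := by ring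
        _ ≤ m * s ^ 2 * ‖x 0‖ ^ 2 := h4
        _ = m * (s * ‖x 0‖) ^ 2 := by ring
    have h6 : Real.exp (ε * t) * ‖x t‖ ≤ s * ‖x 0‖ :=
      (sq_le_sq₀ (by positivity) (by positivity)).1 h5
    have h7 : ‖x t‖ = Real.exp (-ε * t) * (Real.exp (ε * t) * ‖x t‖) := by
      rw [← mul_assoc, ← Real.exp_add]; simp
    rw [h7]
    calc Real.exp (-ε * t) * (Real.exp (ε * t) * ‖x t‖) ≤ Real.exp (-ε * t) * (s * ‖x 0‖) := by
          gcongr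
      _ ≤ Real.exp (-ε * t) * ((1 + s) * ‖x 0‖) := by gcongr; linarith
      _ = (1 + s) * Real.exp (-ε * t) * ‖x 0‖ := by ring
  · intro xs
    constructor
    · intro hxs
      have h1 := hdiss (WithLp.toLp 2 xs)
      simp only [hxs] at h1
      have e : lurPhi (lurJ xs) (lurJ (0 : Fin n → ℝ)) = 0 := by
        ext i j; simp [lurPhi, lurJ]
      rw [e, map_zero] at h1
      have h2 : ‖(WithLp.toLp 2 xs : EuclideanSpace ℝ (Fin n))‖ = 0 := by
        by_contra hne
        have : 0 < ‖(WithLp.toLp 2 xs : EuclideanSpace ℝ (Fin n))‖ ^ 2 := by positivity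
        nlinarith
      have h3 := norm_eq_zero.1 h2
      simpa using congrArg WithLp.ofLp h3
    · rintro rfl
      simp [h0]
end
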